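/- Let n ≥ 6 and let β = (β_1,…,β_d) be a partition of n all of whose parts satisfy β_i ≥ 3. Suppose rational numbers a_1,…,a_n satisfy the identity of bivariate polynomials ∏_{i=1}^d (X^{β_i} − Y^{β_i}) = Σ_{i=1}^n a_i · (X−Y)^{n−i} (X^i − Y^i). Then P_{[2,n−2],β}(x) = Σ_{i=1}^n a_i · P̃_i(x), where P̃_i(x) = 2x² [ binom(i+x−2, i−2) − binom(x−2, i−2) ] + x(x+1) [ binom(i+x−2, i−3) − binom(x−2, i−3) ]. -/

import Mathlib

open Polynomial
open scoped Classical

/-- The cycle type of a permutation of `Fin n` as a partition of `n`,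
including fixed points as parts equal to `1`. -/
noncomputable def fullCycleType {n : ℕ} (σ : Equiv.Perm (Fin n)) : Multiset ℕ :=
  σ.cycleType + Multiset.replicate (n - σ.cycleType.sum) 1

/-- The number of disjoint cycles of a permutation, fixed points included. -/
noncomputable def numCycles {n : ℕ} (σ : Equiv.Perm (Fin n)) : ℕ :=
  Multiset.card (fullCycleType σ)

/-- The set (conjugacy class) of permutations of `Fin n` with full cycle type `β`. -/
noncomputable def permClass (n : ℕ) (β : Multiset ℕ) : Finset (Equiv.Perm (Fin n)) :=
  Finset.univ.filter (fun ω => fullCycleType ω = β)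

/-- The polynomial `P_{[2,n-2],β}(x) = (n(n-1)/|C_β|) ⬝ Σ_{ρ(ω)=β} x^{κ(αω)}`. -/
noncomputable def Pperm {n : ℕ} (α : Equiv.Perm (Fin n)) (β : Multiset ℕ) : Polynomial ℚ :=
  Polynomial.C (((n : ℚ) * ((n : ℚ) - 1)) / ((permClass n β).card : ℚ)) *
    ∑ ω ∈ permClass n β, Polynomial.X ^ (numCycles (α * ω))

/-- The polynomial `binom(x + c, k)` in `x`: for `k ≥ 0` it is
`(x+c)(x+c-1)⋯(x+c-k+1)/k!`, and it is `0` for `k < 0`. -/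
noncomputable def binomPoly (c k : ℤ) : Polynomial ℚ :=
  if 0 ≤ k then
    (((k.toNat).factorial : ℚ))⁻¹ •
      ((descPochhammer ℚ k.toNat).comp (Polynomial.X + Polynomial.C (c : ℚ)))
  else 0

/-- The signless Stirling number of the first kind: the number of permutations of
an `N`-element set with exactly `m` cycles (fixed points included). -/
noncomputable def stirling1 (N m : ℕ) : ℕ :=
  (Finset.univ.filter (fun σ : Equiv.Perm (Fin N) => numCycles σ = m)).card

/-- For a Young diagram with row lengths `L` (rows and columns 0-indexed),
the product `∏_{u} (t + c(u))` over the cells `u`, `c(u)` being the content. -/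
def contentProd (L : List ℕ) (t : ℤ) : ℤ :=
  ∏ i ∈ Finset.range L.length, ∏ j ∈ Finset.range (L.getD i 0), (t + (j : ℤ) - (i : ℤ))

/-- `C(a, b)` for an integer `b`: the usual binomial coefficient when `b ≥ 0`
(which is `0` for `b > a`), and `0` when `b < 0`. -/
def chooseZ (a : ℕ) (b : ℤ) : ℚ := if 0 ≤ b then (a.choose b.toNat : ℚ) else 0

/-- The functional `X ^ a ↦ (q + a)(q + a - 1)⋯(q + a - k + 1)`. -/
noncomputable def fallEval (q : ℚ) (k : ℕ) : ℚ[X] →ₗ[ℚ] ℚ :=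
  Polynomial.lsum fun a => (descPochhammer ℚ k).eval (q + a) • LinearMap.id

lemma fallEval_monomial (q : ℚ) (k a : ℕ) (c : ℚ) :
    fallEval q k (monomial a c) = (descPochhammer ℚ k).eval (q + a) * c := by
  simp [fallEval, Polynomial.lsum_apply]

lemma fallEval_X_pow (q : ℚ) (k a : ℕ) :
    fallEval q k (X ^ a) = (descPochhammer ℚ k).eval (q + a) := by
  rw [← monomial_one_right_eq_X_pow, fallEval_monomial, mul_one]

lemma fallEval_one (q : ℚ) (k : ℕ) :
    fallEval q k 1 = (descPochhammer ℚ k).eval q := by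
  simpa using fallEval_X_pow q k 0

lemma fallEval_C_mul (q : ℚ) (k : ℕ) (c : ℚ) (p : ℚ[X]) :
    fallEval q k (C c * p) = c * fallEval q k p := by
  rw [C_mul', map_smul, smul_eq_mul]

lemma fallEval_X_mul (q : ℚ) (k : ℕ) (p : ℚ[X]) :
    fallEval q k (X * p) = fallEval (q + 1) k p := by
  induction p using Polynomial.induction_on' with
  | add p r hp hr => rw [mul_add, map_add, hp, hr, map_add]
  | monomial a c =>
    rw [X_mul_monomial, fallEval_monomial, fallEval_monomial]
    push_cast
    ring_nf

lemma descPochhammer_eval_add_one_sub (k : ℕ) (x : ℚ) :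
    (descPochhammer ℚ (k + 1)).eval (x + 1) - (descPochhammer ℚ (k + 1)).eval x =
      (k + 1) * (descPochhammer ℚ k).eval x := by
  have h1 : (descPochhammer ℚ (k + 1)).eval (x + 1) = (x + 1) * (descPochhammer ℚ k).eval x := by
    rw [descPochhammer_succ_left]
    simp
  rw [h1, descPochhammer_succ_eval]
  ring

lemma fallEval_X_sub_one_mul (q : ℚ) (k : ℕ) (p : ℚ[X]) :
    fallEval q (k + 1) ((X - 1) * p) = (k + 1) * fallEval q k p := by
  induction p using Polynomial.induction_on' with
  | add p r hp hr => rw [mul_add, map_add, hp, hr, map_add, mul_add]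
  | monomial a c =>
    rw [sub_mul, one_mul, X_mul_monomial, map_sub, fallEval_monomial, fallEval_monomial,
      fallEval_monomial, ← mul_assoc, ← descPochhammer_eval_add_one_sub]
    push_cast
    ring_nf

lemma fallEval_succ (q : ℚ) (k : ℕ) (p : ℚ[X]) :
    fallEval q (k + 1) p = fallEval q k (C (q - k) * p + X * derivative p) := by
  induction p using Polynomial.induction_on' with
  | add p r hp hr => rw [map_add, hp, hr, ← map_add, derivative_add]; ring_nf
  | monomial a c =>
    rcases a with _ | a
    · simp only [derivative_monomial, C_mul_monomial, map_add, fallEval_monomial,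
        descPochhammer_succ_eval]
      simp
      ring
    · simp only [derivative_monomial, C_mul_monomial, X_mul_monomial, map_add, fallEval_monomial,
        descPochhammer_succ_eval]
      simp
      ring

lemma fallEval_X_sub_one_pow_mul (q : ℚ) (k j : ℕ) (p : ℚ[X]) :
    fallEval q (k + j) ((X - 1) ^ j * p) = ((k + j).factorial / k.factorial : ℚ) * fallEval q k p := by
  induction j with
  | zero => simp [Nat.factorial_ne_zero]
  | succ j ih =>
    rw [pow_succ', mul_assoc, ← add_assoc, fallEval_X_sub_one_mul, ih, Nat.factorial_succ]
    push_cast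
    ring

/-- The linear functional carrying `∏ (X ^ β i - 1)` to `(n - 1)!` times the value at `q` of
`P_{[2, n - 2], β}`. -/
noncomputable def hookFunctional (q : ℚ) (n : ℕ) (F : ℚ[X]) : ℚ :=
  (n : ℚ)⁻¹ * fallEval q n
      ((X - 1) * (2 * ((n : ℚ[X]) - 1) * X * derivative F + 2 * derivative F
          - (n : ℚ[X]) * ((n : ℚ[X]) - 1) * F) - 2 * (n : ℚ[X]) * F
        - (X - 1) ^ 2 * (X + 1) * derivative (derivative F)) +
    2 * q * fallEval (q - 1) (n - 1)
      ((n : ℚ[X]) * X * F - 2 * (X - 1) * X * derivative F + (X - 1) ^ 2 * derivative F)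

lemma hookFunctional_sub (q : ℚ) (n : ℕ) (F G : ℚ[X]) :
    hookFunctional q n (F - G) = hookFunctional q n F - hookFunctional q n G := by
  have key (a b c d e f : ℚ) (h1 : a = b - c) (h2 : d = e - f) :
      (n : ℚ)⁻¹ * a + 2 * q * d = ((n : ℚ)⁻¹ * b + 2 * q * e) - ((n : ℚ)⁻¹ * c + 2 * q * f) := by
    rw [h1, h2]; ring
  apply key <;> rw [← map_sub] <;> congr 1 <;> simp only [derivative_sub] <;> ring

lemma hookFunctional_C_mul (q : ℚ) (n : ℕ) (c : ℚ) (F : ℚ[X]) :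
    hookFunctional q n (C c * F) = c * hookFunctional q n F := by
  have key (a b d e : ℚ) (h1 : a = c * b) (h2 : d = c * e) :
      (n : ℚ)⁻¹ * a + 2 * q * d = c * ((n : ℚ)⁻¹ * b + 2 * q * e) := by
    rw [h1, h2]; ring
  apply key <;> rw [← fallEval_C_mul] <;> congr 1 <;> simp only [derivative_C_mul] <;> ring

lemma hookFunctional_add (q : ℚ) (n : ℕ) (F G : ℚ[X]) :
    hookFunctional q n (F + G) = hookFunctional q n F + hookFunctional q n G := by
  have h := hookFunctional_sub q n (F + G) G
  rw [add_sub_cancel_right] at h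
  linarith

lemma hookFunctional_sum (q : ℚ) (n : ℕ) {ι : Type*} (s : Finset ι) (F : ι → ℚ[X]) :
    hookFunctional q n (∑ i ∈ s, F i) = ∑ i ∈ s, hookFunctional q n (F i) := by
  induction s using Finset.induction_on with
  | empty => simp [hookFunctional]
  | insert i s hi ih => rw [Finset.sum_insert hi, Finset.sum_insert hi, hookFunctional_add, ih]

lemma hookFunctional_X_sub_one_pow_mul (q : ℚ) (j m : ℕ) (p : ℚ[X]) :
    hookFunctional q (m + 1 + j) ((X - 1) ^ j * p) =
      ((m + j).factorial / m.factorial : ℚ) *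
      ((m + 1 : ℚ)⁻¹ * fallEval q (m + 1)
        ((2 * ((m : ℚ[X]) + (j : ℚ[X])) * X + 2) * ((j : ℚ[X]) * p + (X - 1) * derivative p) -
          ((m : ℚ[X]) + (j : ℚ[X]) + 1) * ((m : ℚ[X]) + (j : ℚ[X])) * ((X - 1) * p) - 2 * ((m : ℚ[X]) + (j : ℚ[X]) + 1) * p -
          (X + 1) * ((j : ℚ[X]) * ((j : ℚ[X]) - 1) * p + 2 * (j : ℚ[X]) * ((X - 1) * derivative p) +
            (X - 1) ^ 2 * derivative (derivative p))) +
      2 * q * fallEval (q - 1) m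
        (((m : ℚ[X]) + (j : ℚ[X]) + 1) * X * p - 2 * X * ((j : ℚ[X]) * p + (X - 1) * derivative p) +
          (X - 1) * ((j : ℚ[X]) * p + (X - 1) * derivative p))) := by
  have hd1 : (X - 1) * derivative ((X - 1 : ℚ[X]) ^ j * p) =
      (X - 1) ^ j * ((j : ℚ[X]) * p + (X - 1) * derivative p) := by
    rcases j with _ | j
    · simp
    · simp [derivative_pow]
      ring
  have hd2 : (X - 1) ^ 2 * derivative (derivative ((X - 1 : ℚ[X]) ^ j * p)) =
      (X - 1) ^ j * ((j : ℚ[X]) * ((j : ℚ[X]) - 1) * p + 2 * (j : ℚ[X]) * ((X - 1) * derivative p) +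
            (X - 1) ^ 2 * derivative (derivative p)) := by
    have h := congrArg derivative hd1
    simp only [derivative_mul, derivative_sub, derivative_X, derivative_one, derivative_add,
      derivative_natCast] at h
    have h' : (X - 1) * derivative ((X - 1 : ℚ[X]) ^ j) = (X - 1) ^ j * (j : ℚ[X]) := by
      rcases j with _ | j
      · simp
      · simp [derivative_pow]
        ring
    rw [← derivative_mul] at h
    simp only [derivative_mul] at h hd1 ⊢
    simp only [derivative_add, derivative_mul] at h ⊢
    linear_combination (X - 1) * h - hd1 + ((j : ℚ[X]) * p + (X - 1) * derivative p) * h'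
  have hA : (X - 1) * (2 * (((m + 1 + j : ℕ) : ℚ[X]) - 1) * X * derivative ((X - 1 : ℚ[X]) ^ j * p)
        + 2 * derivative ((X - 1 : ℚ[X]) ^ j * p)
        - ((m + 1 + j : ℕ) : ℚ[X]) * (((m + 1 + j : ℕ) : ℚ[X]) - 1) * ((X - 1 : ℚ[X]) ^ j * p)) -
        2 * ((m + 1 + j : ℕ) : ℚ[X]) * ((X - 1 : ℚ[X]) ^ j * p)
        - (X - 1) ^ 2 * (X + 1) * derivative (derivative ((X - 1 : ℚ[X]) ^ j * p)) =
      (X - 1) ^ j * ((2 * ((m : ℚ[X]) + (j : ℚ[X])) * X + 2) * ((j : ℚ[X]) * p + (X - 1) * derivative p) -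
          ((m : ℚ[X]) + (j : ℚ[X]) + 1) * ((m : ℚ[X]) + (j : ℚ[X])) * ((X - 1) * p) - 2 * ((m : ℚ[X]) + (j : ℚ[X]) + 1) * p -
          (X + 1) * ((j : ℚ[X]) * ((j : ℚ[X]) - 1) * p + 2 * (j : ℚ[X]) * ((X - 1) * derivative p) +
            (X - 1) ^ 2 * derivative (derivative p))) := by
    push_cast
    linear_combination (2 * ((m : ℚ[X]) + (j : ℚ[X])) * X + 2) * hd1 - (X + 1) * hd2
  have hB : ((m + 1 + j : ℕ) : ℚ[X]) * X * ((X - 1 : ℚ[X]) ^ j * p)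
        - 2 * (X - 1) * X * derivative ((X - 1 : ℚ[X]) ^ j * p)
        + (X - 1) ^ 2 * derivative ((X - 1 : ℚ[X]) ^ j * p) =
      (X - 1) ^ j * (((m : ℚ[X]) + (j : ℚ[X]) + 1) * X * p - 2 * X * ((j : ℚ[X]) * p + (X - 1) * derivative p) +
          (X - 1) * ((j : ℚ[X]) * p + (X - 1) * derivative p)) := by
    push_cast
    linear_combination (-2 * X + (X - 1)) * hd1
  rw [hookFunctional, hA, hB, fallEval_X_sub_one_pow_mul,
    show m + 1 + j - 1 = m + j by omega, fallEval_X_sub_one_pow_mul,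
    show m + 1 + j = m + j + 1 by omega, Nat.factorial_succ, Nat.factorial_succ]
  have h1 : (m.factorial : ℚ) ≠ 0 := by positivity
  have h2 : (m + 1 : ℚ) ≠ 0 := by positivity
  have h3 : (m + j + 1 : ℚ) ≠ 0 := by positivity
  push_cast
  field_simp

lemma descPochhammer_eval_add_one (k : ℕ) (x : ℚ) :
    (descPochhammer ℚ (k + 1)).eval (x + 1) = (x + 1) * (descPochhammer ℚ k).eval x := by
  rw [descPochhammer_succ_left]
  simp

lemma hookFunctional_X_pow (q : ℚ) (j e : ℕ) :
    hookFunctional q (e + 2 + j) ((X - 1) ^ j * X ^ (e + 2)) =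
      ((e + 1 + j).factorial / e.factorial : ℚ) *
        ((descPochhammer ℚ e).eval (q + e) * q * (2 * q + e)) := by
  rw [show e + 2 + j = (e + 1) + 1 + j by ring, hookFunctional_X_sub_one_pow_mul]
  set V := (descPochhammer ℚ e).eval (q + e) with hV
  have e0 : fallEval q (e + 1 + 1) (X ^ e) = V * q * (q - 1) := by
    rw [fallEval_X_pow, descPochhammer_succ_eval, descPochhammer_succ_eval]
    push_cast; ring
  have e1 : fallEval q (e + 1 + 1) (X ^ (e + 1)) = (q + e + 1) * V * q := by
    rw [fallEval_X_pow]
    push_cast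
    rw [← add_assoc, descPochhammer_eval_add_one, descPochhammer_succ_eval]
    ring
  have f1 : fallEval (q - 1) (e + 1) (X ^ (e + 1)) = V * q := by
    rw [fallEval_X_pow]
    push_cast
    rw [show q - 1 + (e + 1 : ℚ) = q + e by ring, descPochhammer_succ_eval]
    ring
  have f2 : fallEval (q - 1) (e + 1) (X ^ (e + 2)) = (q + e + 1) * V := by
    rw [fallEval_X_pow]
    push_cast
    rw [show q - 1 + (e + 2 : ℚ) = q + e + 1 by ring, descPochhammer_eval_add_one]
  have d1 : derivative (X ^ (e + 1 + 1) : ℚ[X]) = ((e : ℚ[X]) + 2) * X ^ (e + 1) := by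
    simp [derivative_pow]; ring
  have d2 : derivative (derivative (X ^ (e + 1 + 1) : ℚ[X])) = ((e : ℚ[X]) + 2) * ((e : ℚ[X]) + 1) * X ^ e := by
    rw [d1]; simp [derivative_pow]; ring
  rw [d2, d1]
  have hA : (2 * (((e + 1 : ℕ) : ℚ[X]) + (j : ℚ[X])) * X + 2) * ((j : ℚ[X]) * X ^ (e + 1 + 1) +
        (X - 1) * (((e : ℚ[X]) + 2) * X ^ (e + 1))) -
      (((e + 1 : ℕ) : ℚ[X]) + (j : ℚ[X]) + 1) * (((e + 1 : ℕ) : ℚ[X]) + (j : ℚ[X])) *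
        ((X - 1) * X ^ (e + 1 + 1)) - 2 * (((e + 1 : ℕ) : ℚ[X]) + (j : ℚ[X]) + 1) * X ^ (e + 1 + 1) -
      (X + 1) * ((j : ℚ[X]) * ((j : ℚ[X]) - 1) * X ^ (e + 1 + 1) +
        2 * (j : ℚ[X]) * ((X - 1) * (((e : ℚ[X]) + 2) * X ^ (e + 1))) +
        (X - 1) ^ 2 * (((e : ℚ[X]) + 2) * ((e : ℚ[X]) + 1) * X ^ e)) =
      C (((e : ℚ) + 2) * (2 * j + e - 1)) * X ^ (e + 1) - C (((e : ℚ) + 2) * (e + 1)) * X ^ e := by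
    simp only [map_mul, map_add, map_sub, map_natCast, map_ofNat, map_one]
    push_cast
    ring
  have hB : (((e + 1 : ℕ) : ℚ[X]) + (j : ℚ[X]) + 1) * X * X ^ (e + 1 + 1) -
      2 * X * ((j : ℚ[X]) * X ^ (e + 1 + 1) + (X - 1) * (((e : ℚ[X]) + 2) * X ^ (e + 1))) +
      (X - 1) * ((j : ℚ[X]) * X ^ (e + 1 + 1) + (X - 1) * (((e : ℚ[X]) + 2) * X ^ (e + 1))) =
      C ((e : ℚ) + 2) * X ^ (e + 1) - C (j : ℚ) * X ^ (e + 2) := by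
    simp only [map_add, map_natCast, map_ofNat]
    push_cast
    ring
  rw [hA, hB]
  simp only [map_sub, fallEval_C_mul, e0, e1, f1, f2, Nat.factorial_succ]
  have h1 : (e.factorial : ℚ) ≠ 0 := by positivity
  push_cast
  field_simp
  ring

lemma hookFunctional_one (q : ℚ) (j e : ℕ) :
    hookFunctional q (e + 2 + j) ((X - 1) ^ j) =
      ((e + 1 + j).factorial / e.factorial : ℚ) *
        ((descPochhammer ℚ (e + 1)).eval q * (2 * q - e)) := by
  have h := hookFunctional_X_sub_one_pow_mul q j (e + 1) 1
  rw [mul_one, show e + 1 + 1 + j = e + 2 + j by ring] at h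
  rw [h]
  set V := (descPochhammer ℚ (e + 1)).eval q with hV
  have e0 : fallEval q (e + 1 + 1) 1 = V * (q - e - 1) := by
    rw [fallEval_one, descPochhammer_succ_eval]
    push_cast; ring
  have e1 : fallEval q (e + 1 + 1) X = (q + 1) * V := by
    have := fallEval_X_pow q (e + 1 + 1) 1
    rw [pow_one, Nat.cast_one, descPochhammer_eval_add_one] at this
    exact this
  have f0 : q * fallEval (q - 1) (e + 1) 1 = V * (q - e - 1) := by
    have h1 := descPochhammer_eval_add_one (e + 1) (q - 1)
    rw [sub_add_cancel] at h1
    rw [fallEval_one, ← h1, descPochhammer_succ_eval]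
    push_cast; ring
  have f1 : fallEval (q - 1) (e + 1) X = V := by
    have := fallEval_X_pow (q - 1) (e + 1) 1
    rw [pow_one, Nat.cast_one, sub_add_cancel] at this
    exact this
  simp only [derivative_one, mul_zero, add_zero, derivative_zero, mul_one]
  have hA : (2 * (((e + 1 : ℕ) : ℚ[X]) + (j : ℚ[X])) * X + 2) * (j : ℚ[X]) -
      (((e + 1 : ℕ) : ℚ[X]) + (j : ℚ[X]) + 1) * (((e + 1 : ℕ) : ℚ[X]) + (j : ℚ[X])) * (X - 1) -
      2 * (((e + 1 : ℕ) : ℚ[X]) + (j : ℚ[X]) + 1) -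
      (X + 1) * ((j : ℚ[X]) * ((j : ℚ[X]) - 1)) =
      C (- ((e : ℚ) + 2) * (e + 1)) * X +
        C ((2 * j + (e + j + 2) * (e + j + 1) - 2 * (e + j + 2) - j * (j - 1) : ℚ)) * 1 := by
    simp only [map_mul, map_add, map_sub, map_natCast, map_ofNat, map_one, map_neg]
    push_cast
    ring
  have hB : (((e + 1 : ℕ) : ℚ[X]) + (j : ℚ[X]) + 1) * X - 2 * X * (j : ℚ[X]) +
      (X - 1) * (j : ℚ[X]) =
      C ((e : ℚ) + 2) * X - C (j : ℚ) * 1 := by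
    simp only [map_add, map_natCast, map_ofNat]
    push_cast
    ring
  rw [hA, hB, (fallEval q (e + 1 + 1)).map_add, (fallEval (q - 1) (e + 1)).map_sub, fallEval_C_mul,
    fallEval_C_mul, fallEval_C_mul, fallEval_C_mul, e0, e1, f1, Nat.factorial_succ]
  have h1 : (e.factorial : ℚ) ≠ 0 := by positivity
  push_cast
  field_simp
  linear_combination (-2 * (e + 2 : ℚ) * (j : ℚ)) * f0

lemma hookFunctional_hook_one (q : ℚ) (j : ℕ) :
    hookFunctional q (j + 1) ((X - 1) ^ j * (X - 1)) = 0 := by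
  have h := hookFunctional_X_sub_one_pow_mul q j 0 (X - 1)
  have hA : (2 * (((0 : ℕ) : ℚ[X]) + (j : ℚ[X])) * X + 2) * ((j : ℚ[X]) * (X - 1) + (X - 1) * 1) -
      (((0 : ℕ) : ℚ[X]) + (j : ℚ[X]) + 1) * (((0 : ℕ) : ℚ[X]) + (j : ℚ[X])) *
        ((X - 1) * (X - 1)) - 2 * (((0 : ℕ) : ℚ[X]) + (j : ℚ[X]) + 1) * (X - 1) -
      (X + 1) * ((j : ℚ[X]) * ((j : ℚ[X]) - 1) * (X - 1) +
        2 * (j : ℚ[X]) * ((X - 1) * 1) + (X - 1) ^ 2 * 0) = 0 := by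
    push_cast
    ring
  have hB : (((0 : ℕ) : ℚ[X]) + (j : ℚ[X]) + 1) * X * (X - 1) -
      2 * X * ((j : ℚ[X]) * (X - 1) + (X - 1) * 1) +
      (X - 1) * ((j : ℚ[X]) * (X - 1) + (X - 1) * 1) =
      C (-(j + 1 : ℚ)) * (X - 1) := by
    simp only [map_add, map_natCast, map_neg, map_one]
    push_cast
    ring
  have hL : fallEval (q - 1) 0 (X - 1) = 0 := by
    have := fallEval_X_pow (q - 1) 0 1
    rw [pow_one] at this
    rw [map_sub, this, fallEval_one]
    simp
  simp only [derivative_sub, derivative_X, derivative_one, sub_zero] at h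
  rw [hA, hB, fallEval_C_mul, hL] at h
  rw [show j + 1 = 0 + 1 + j by ring, h]
  simp

lemma binomPoly_natCast_eval (c : ℤ) (k : ℕ) (q : ℚ) :
    (binomPoly c k).eval q = (k.factorial : ℚ)⁻¹ * (descPochhammer ℚ k).eval (q + c) := by
  simp [binomPoly]

lemma eval_hook (q : ℚ) (i j : ℕ) (hi : 1 ≤ i) :
    (2 * X ^ 2 * (binomPoly ((i : ℤ) - 2) ((i : ℤ) - 2) - binomPoly (-2) ((i : ℤ) - 2))
          + X * (X + 1) *
            (binomPoly ((i : ℤ) - 2) ((i : ℤ) - 3) - binomPoly (-2) ((i : ℤ) - 3))).eval q =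
      hookFunctional q (i + j) ((X - 1) ^ j * (X ^ i - 1)) / (i + j - 1).factorial := by
  obtain rfl | ⟨e, rfl⟩ : i = 1 ∨ ∃ e, i = e + 2 := by
    rcases i with _ | _ | e
    · omega
    · exact Or.inl rfl
    · exact Or.inr ⟨e, rfl⟩
  · rw [pow_one, add_comm 1 j, hookFunctional_hook_one]
    simp [binomPoly]
  rw [mul_sub ((X - 1 : ℚ[X]) ^ j), hookFunctional_sub, hookFunctional_X_pow, mul_one, hookFunctional_one,
    show e + 2 + j - 1 = e + 1 + j by omega]
  have h0 : ((e + 1 + j).factorial : ℚ) ≠ 0 := by positivity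
  have h1 : (e.factorial : ℚ) ≠ 0 := by positivity
  have hc : ((e + 2 : ℕ) : ℤ) - 2 = (e : ℤ) := by push_cast; ring
  rw [hc]
  rcases e with _ | e
  · have hb (c : ℤ) : binomPoly c (((0 + 2 : ℕ) : ℤ) - 3) = 0 := by simp [binomPoly]
    rw [hb, hb]
    simp only [eval_add, eval_mul, eval_sub, eval_pow, eval_X, eval_ofNat, eval_one, eval_zero,
      binomPoly_natCast_eval]
    simp
  · have hc' : ((e + 1 + 2 : ℕ) : ℤ) - 3 = (e : ℤ) := by push_cast; ring
    rw [hc']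
    simp only [eval_add, eval_mul, eval_sub, eval_pow, eval_X, eval_ofNat, eval_one,
      binomPoly_natCast_eval]
    have a1 : (descPochhammer ℚ (e + 1)).eval (q + (e + 1 : ℕ)) =
        (descPochhammer ℚ e).eval (q + (e + 1 : ℕ)) * (q + 1) := by
      rw [descPochhammer_succ_eval]
      push_cast
      ring
    have a2 : (descPochhammer ℚ (e + 1 + 1)).eval q =
        q * (q - 1) * (descPochhammer ℚ e).eval (q - 2) := by
      have b1 := descPochhammer_eval_add_one (e + 1) (q - 1)
      have b2 := descPochhammer_eval_add_one e (q - 2)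
      rw [show q - 2 + 1 = q - 1 by ring] at b2
      rw [sub_add_cancel, b2] at b1
      rw [b1]
      ring
    have a3 : (descPochhammer ℚ (e + 1)).eval (q - 2) =
        (descPochhammer ℚ e).eval (q - 2) * (q - 2 - e) := descPochhammer_succ_eval _ _
    have a4 : (q : ℚ) + ((-2 : ℤ) : ℚ) = q - 2 := by push_cast; ring
    rw [a2, a4, a3, Int.cast_natCast, a1, Nat.factorial_succ]
    have h2 : (e.factorial : ℚ) ≠ 0 := by positivity
    push_cast
    field_simp
    ring

section Determinants

open Matrix

variable {V : Type*} [Fintype V] [DecidableEq V] {R : Type*} [CommRing R]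

lemma det_updateRow_updateRow_one {r s : V} (hrs : r ≠ s) (u v : V → R) :
    (((1 : Matrix V V R).updateRow r u).updateRow s v).det = u r * v s - u s * v r := by
  have h : ((1 : Matrix V V R).updateRow r u).updateRow s v =
      1 + (Matrix.of fun i (k : Fin 2) => if i = ![r, s] k then (1 : R) else 0) *
        (Matrix.of (![u - Pi.single r 1, v - Pi.single s 1] : Fin 2 → V → R)) := by
    ext i j
    rw [Matrix.add_apply, Matrix.mul_apply, Fin.sum_univ_two]
    by_cases h1 : i = s
    · subst h1
      simp [hrs.symm, one_apply, Pi.single_apply, eq_comm]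
    · by_cases h2 : i = r
      · subst h2
        simp [hrs, one_apply, Pi.single_apply, eq_comm]
      · simp [h1, h2]
  rw [h, det_one_add_mul_comm, det_fin_two]
  have h' (w : V → R) (k : Fin 2) :
      (w ᵥ* Matrix.of fun i (k : Fin 2) => if i = ![r, s] k then (1 : R) else 0) k =
        w (![r, s] k) := by
    simp only [vecMul, dotProduct, of_apply, mul_ite, mul_one, mul_zero, Finset.sum_ite_eq',
      Finset.mem_univ, if_true]
  simp [h', hrs, hrs.symm]

lemma det_updateRow_updateRow {M K : Matrix V V R} (hK : K * M = 1) {r s : V} (hrs : r ≠ s)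
    (a b : V → R) :
    ((M.updateRow r a).updateRow s b).det =
      M.det * ((a ᵥ* K) r * (b ᵥ* K) s - (a ᵥ* K) s * (b ᵥ* K) r) := by
  have h : (M.updateRow r a).updateRow s b =
      (((1 : Matrix V V R).updateRow r (a ᵥ* K)).updateRow s (b ᵥ* K)) * M := by
    rw [updateRow_mul, updateRow_mul, one_mul, vecMul_vecMul, vecMul_vecMul, hK, vecMul_one,
      vecMul_one]
  rw [h, det_mul, det_updateRow_updateRow_one hrs, mul_comm]

lemma det_updateRow_eq {M K : Matrix V V R} (hK : K * M = 1) (r : V) (a : V → R) :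
    (M.updateRow r a).det = M.det * (a ᵥ* K) r := by
  have h : M.updateRow r a = ((1 : Matrix V V R).updateRow r (a ᵥ* K)) * M := by
    rw [updateRow_mul, one_mul, vecMul_vecMul, hK, vecMul_one]
  rw [h, det_mul, mul_comm]
  congr 1
  have := cramer_transpose_apply (1 : Matrix V V R) (a ᵥ* K) r
  rw [← this]
  simp

lemma det_option {A : Matrix (Option V) (Option V) R} {c c' : R} (hc : c * c' = 1)
    (hA : A none none = c) :
    A.det = c * (Matrix.of fun i j =>
      A (some i) (some j) - c' * (A (some i) none * A none (some j))).det := by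
  let e := Equiv.optionEquivSumPUnit.{0} V
  let D : Matrix PUnit.{1} PUnit.{1} R := Matrix.of fun _ _ => c
  let _ : Invertible D := ⟨Matrix.of fun _ _ => c',
    by ext; simp [D, mul_apply, mul_comm c' c, hc], by ext; simp [D, mul_apply, hc]⟩
  have h : A.submatrix e.symm e.symm = fromBlocks (Matrix.of fun i j => A (some i) (some j))
      (Matrix.of fun i _ => A (some i) none) (Matrix.of fun _ j => A none (some j)) D := by
    ext i j
    rcases i with i | i <;> rcases j with j | j <;> simp [e, D, hA]
  rw [← det_submatrix_equiv_self e.symm A, h, det_fromBlocks₂₂]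
  congr 1
  · simp [D]
  · congr 1
    ext i j
    have : (⅟D : Matrix PUnit.{1} PUnit.{1} R) = Matrix.of fun _ _ => c' := rfl
    rw [this]
    simp [mul_apply]
    ring

lemma derivative_det (M : Matrix V V R[X]) :
    derivative M.det = ∑ r, (M.updateRow r fun j => derivative (M r j)).det := by
  rw [← det_transpose, det_apply', derivative_sum]
  have h (r : V) : (M.updateRow r fun j => derivative (M r j)).det =
      ∑ σ : Equiv.Perm V, (Equiv.Perm.sign σ : R[X]) *
        ((∏ j ∈ Finset.univ.erase r, M j (σ j)) * derivative (M r (σ r))) := by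
    rw [← det_transpose, det_apply']
    refine Finset.sum_congr rfl fun σ _ => ?_
    congr 1
    rw [← Finset.prod_erase_mul _ _ (Finset.mem_univ r)]
    congr 1
    · refine Finset.prod_congr rfl fun j hj => ?_
      rw [transpose_apply, updateRow_ne (Finset.ne_of_mem_erase hj)]
    · rw [transpose_apply, updateRow_self]
  simp_rw [h]
  rw [Finset.sum_comm]
  refine Finset.sum_congr rfl fun σ _ => ?_
  rw [derivative_intCast_mul, derivative_prod_finset, ← Finset.mul_sum]
  rfl

end Determinants

section PermDiff

open Matrix Equiv

variable {V : Type*} [DecidableEq V] {R : Type*} [CommRing R]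

/-- The diagonal matrix with entries `x` minus the permutation matrix of `σ`. -/
def permDiff (x : V → R) (σ : Perm V) : Matrix V V R :=
  Matrix.of fun i j => (if i = j then x i else 0) - if σ i = j then 1 else 0

lemma permDiff_apply (x : V → R) (σ : Perm V) (i j : V) :
    permDiff x σ i j = (if i = j then x i else 0) - if σ i = j then 1 else 0 := rfl

lemma permDiff_row (x : V → R) (σ : Perm V) (i : V) :
    permDiff x σ i = x i • Pi.single i 1 - Pi.single (σ i) 1 := by
  ext j
  simp [permDiff_apply, Pi.single_apply, eq_comm]

lemma permDiff_swap_mul (x : V → R) (τ : Perm V) {r s : V} :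
    permDiff x (swap (τ r) (τ s) * τ) =
      ((permDiff x τ).updateRow r (x r • Pi.single r 1 - Pi.single (τ s) 1)).updateRow s
        (x s • Pi.single s 1 - Pi.single (τ r) 1) := by
  ext i j
  by_cases h1 : i = s
  · subst h1
    rw [updateRow_self, permDiff_row]
    simp
  by_cases h2 : i = r
  · subst h2
    rw [updateRow_ne h1, updateRow_self, permDiff_row]
    simp
  · rw [updateRow_ne h1, updateRow_ne h2, permDiff_row, permDiff_row, Perm.mul_apply,
      swap_apply_of_ne_of_ne (by simpa using h2) (by simpa using h1)]

variable [Fintype V]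

/-- The characteristic polynomial of the permutation matrix of `σ`. -/
noncomputable def permCharpoly (σ : Perm V) : ℚ[X] := (permDiff (fun _ => (X : ℚ[X])) σ).det

lemma permCharpoly_monic (σ : Perm V) : (permCharpoly σ).Monic := by
  have h : permDiff (fun _ => (X : ℚ[X])) σ =
      charmatrix (Matrix.of fun i j => if σ i = j then (1 : ℚ) else 0) := by
    ext1 i j
    rw [permDiff_apply, charmatrix_apply, diagonal_apply, of_apply]
    split_ifs <;> simp
  rw [permCharpoly, h]
  exact charpoly_monic _

lemma permDiff_map {S : Type*} [CommRing S] (f : R →+* S) (x : V → R) (σ : Perm V) :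
    f (permDiff x σ).det = (permDiff (fun i => f (x i)) σ).det := by
  rw [RingHom.map_det]
  congr 1
  ext i j
  simp only [RingHom.mapMatrix_apply, Matrix.map_apply, permDiff_apply]
  split_ifs <;> simp

lemma removeNone_eq_iff {U : Type*} (σ : Perm (Option U)) (i j : U) :
    removeNone σ i = j ↔ σ (some i) = some j ∨ (σ (some i) = none ∧ σ none = some j) := by
  rcases h : σ (some i) with _ | w
  · have := removeNone_none σ h
    simp [← this]
  · have := removeNone_some σ ⟨w, h⟩
    rw [h] at this
    simpa using by rw [← Option.some_inj, this, Option.some_inj]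

lemma removeNone_optionCongr_of_fixed {U : Type*} {σ : Perm (Option U)} (h : σ none = none)
    (i : U) : σ (some i) = some (removeNone σ i) := by
  rcases (removeNone_eq_iff σ i _).1 rfl with h' | h'
  · exact h'
  · simp [h] at h'

lemma det_permDiff_option_fixed {x : Option V → R} {c' : R} (hc : (x none - 1) * c' = 1)
    {σ : Perm (Option V)} (h : σ none = none) :
    (permDiff x σ).det = (x none - 1) * (permDiff (fun i => x (some i)) (removeNone σ)).det := by
  rw [det_option hc (by simp [permDiff_apply, h])]
  congr 2
  ext i j
  simp [permDiff_apply, h, removeNone_optionCongr_of_fixed h]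

/-- Removing a point of weight one from a cycle does not change the determinant. -/
lemma det_permDiff_option {x : Option V → R} (hx : x none = 1) {σ : Perm (Option V)}
    (h : σ none ≠ none) :
    (permDiff x σ).det = (permDiff (fun i => x (some i)) (removeNone σ)).det := by
  rw [det_option (c := 1) (c' := 1) (mul_one 1) (by simp [permDiff_apply, hx, h]), one_mul]
  congr 1
  ext i j
  simp only [permDiff_apply, of_apply, removeNone_eq_iff]
  rcases h1 : σ (some i) with _ | w
  · split_ifs <;> simp_all
  · simp

lemma det_permDiff_option_eq_zero {x : Option V → R} (hx : x none = 1) {σ : Perm (Option V)}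
    (h : σ none = none) : (permDiff x σ).det = 0 :=
  det_eq_zero_of_row_eq_zero none fun j => by
    by_cases hj : none = j
    · simp [permDiff_apply, hx, h, ← hj]
    · simp [permDiff_apply, h, hj]

lemma det_permDiff_const {W : Type*} [Fintype W] [DecidableEq W] (e : V ≃ W) (x : W → R)
    (σ : Perm V) :
    (permDiff x (e.permCongr σ)).det = (permDiff (fun i => x (e i)) σ).det := by
  rw [← det_submatrix_equiv_self e]
  congr 1
  ext i j
  simp [permDiff_apply]

variable {K : Type*} [Field K] {t : K} {σ : Perm V} {k : Matrix V V K}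

lemma inv_row_eq (hk : permDiff (fun _ => t) σ * k = 1) (x y : V) :
    k (σ x) y = t * k x y - if x = y then 1 else 0 := by
  have h := congrFun (congrFun hk x) y
  rw [mul_apply] at h
  simp [permDiff_apply, sub_mul, one_apply] at h
  rw [← h]; ring

lemma inv_col_eq (hk : k * permDiff (fun _ => t) σ = 1) (x y : V) :
    k x y = t * k x (σ y) - if x = σ y then 1 else 0 := by
  have h := congrFun (congrFun hk x) (σ y)
  rw [mul_apply] at h
  simp [permDiff_apply, mul_sub, one_apply] at h
  rw [← h]; ring

lemma inv_row_sum (hk : k * permDiff (fun _ => t) σ = 1) (x : V) :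
    (t - 1) * ∑ y, k x y = 1 := by
  have h : ∑ y, k x y = ∑ y, (t * k x (σ y) - if x = σ y then 1 else 0) :=
    Finset.sum_congr rfl fun y _ => inv_col_eq hk x y
  rw [Finset.sum_sub_distrib, ← Finset.mul_sum, Equiv.sum_comp σ (fun y => k x y),
    Equiv.sum_comp σ (fun y => if x = y then (1 : K) else 0)] at h
  simp at h
  linear_combination -h

lemma inv_col_sum (hk : permDiff (fun _ => t) σ * k = 1) (y : V) :
    (t - 1) * ∑ x, k x y = 1 := by
  have h : ∑ x, k (σ x) y = ∑ x, (t * k x y - if x = y then 1 else 0) :=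
    Finset.sum_congr rfl fun x _ => inv_row_eq hk x y
  rw [Finset.sum_sub_distrib, ← Finset.mul_sum, Equiv.sum_comp σ (fun x => k x y)] at h
  simp at h
  linear_combination -h

lemma det_permDiff_swap_mul (hk : permDiff (fun _ => t) σ * k = 1)
    (hk' : k * permDiff (fun _ => t) σ = 1) {u w : V} (huw : u ≠ w) :
    (permDiff (fun _ => t) (swap u w * σ)).det =
      (permDiff (fun _ => t) σ).det * (t * (k u u + k w w - k u w - k w u) - 1) := by
  obtain ⟨r, rfl⟩ := σ.surjective u
  obtain ⟨s, rfl⟩ := σ.surjective w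
  have hrs : r ≠ s := fun h => huw (by rw [h])
  rw [permDiff_swap_mul, det_updateRow_updateRow hk' hrs]
  simp only [sub_vecMul, smul_vecMul, single_one_vecMul, Pi.sub_apply, Pi.smul_apply, smul_eq_mul,
    row_apply]
  have h1 : t * k r r = k (σ r) r + 1 := by simp [inv_row_eq hk]
  have h2 : t * k r s = k (σ r) s := by simp [inv_row_eq hk, hrs]
  have h3 : t * k s r = k (σ s) r := by simp [inv_row_eq hk, hrs.symm]
  have h4 : t * k s s = k (σ s) s + 1 := by simp [inv_row_eq hk]
  rw [h1, h2, h3, h4, inv_col_eq hk' (σ r) r, inv_col_eq hk' (σ r) s, inv_col_eq hk' (σ s) r,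
    inv_col_eq hk' (σ s) s, if_pos rfl, if_pos rfl, if_neg huw, if_neg huw.symm]
  ring

lemma det_permDiff_insert (hk : permDiff (fun _ => t) σ * k = 1)
    (hk' : k * permDiff (fun _ => t) σ = 1) (ht : t ≠ 0) (u : V) :
    (permDiff (fun _ => t) (swap none (some u) * optionCongr σ)).det =
      (permDiff (fun _ => t) σ).det * (1 + (t ^ 2 - t) * k u u) := by
  obtain ⟨r, rfl⟩ := σ.surjective u
  rw [det_option (mul_inv_cancel₀ ht) (by simp [permDiff_apply])]
  have h : (Matrix.of fun i j =>
      permDiff (fun _ => t) (swap none (some (σ r)) * optionCongr σ) (some i) (some j) - t⁻¹ *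
        (permDiff (fun _ => t) (swap none (some (σ r)) * optionCongr σ) (some i) none *
          permDiff (fun _ => t) (swap none (some (σ r)) * optionCongr σ) none (some j))) =
      (permDiff (fun _ => t) σ).updateRow r (t • Pi.single r 1 - t⁻¹ • Pi.single (σ r) 1) := by
    ext i j
    by_cases h2 : i = r
    · subst h2
      simp only [permDiff_apply, of_apply, updateRow_self]
      by_cases h3 : σ i = j
      · simp [h3, Pi.single_apply, eq_comm]
      · have h4 : j ≠ σ i := fun h => h3 h.symm
        simp [h4, Pi.single_apply, eq_comm]
    · simp [h2, permDiff_apply, swap_apply_def]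
  rw [h, det_updateRow_eq hk']
  simp only [sub_vecMul, smul_vecMul, single_one_vecMul, Pi.sub_apply, Pi.smul_apply, smul_eq_mul,
    row_apply]
  have h1 : t * k r r = k (σ r) r + 1 := by simp [inv_row_eq hk]
  rw [h1, inv_col_eq hk' (σ r) r, if_pos rfl]
  field_simp
  ring

lemma det_permDiff_two (hk : permDiff (fun _ => t) σ * k = 1)
    (hk' : k * permDiff (fun _ => t) σ = 1) {r s : V} (hrs : r ≠ s) :
    (permDiff (fun i => if i = r ∨ i = s then 1 else t) σ).det =
      (permDiff (fun _ => t) σ).det *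
        (1 - (t - 1) * (k r r + k s s) + (t - 1) ^ 2 * (k r r * k s s - k r s * k s r)) := by
  have h : permDiff (fun i => if i = r ∨ i = s then 1 else t) σ =
      ((permDiff (fun _ => t) σ).updateRow r (Pi.single r 1 - Pi.single (σ r) 1)).updateRow s
        (Pi.single s 1 - Pi.single (σ s) 1) := by
    ext i j
    by_cases h1 : i = s
    · subst h1
      simp [permDiff_row]
    by_cases h2 : i = r
    · subst h2
      simp [updateRow_ne h1, permDiff_row]
    · simp [h1, h2, permDiff_row]
  rw [h, det_updateRow_updateRow hk' hrs]
  simp only [sub_vecMul, single_one_vecMul, Pi.sub_apply, row_apply]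
  rw [inv_row_eq hk r r, inv_row_eq hk r s, inv_row_eq hk s r, inv_row_eq hk s s]
  simp only [if_true, if_neg hrs, if_neg hrs.symm]
  ring

lemma det_permDiff_two_mul_swap (hk : permDiff (fun _ => t) σ * k = 1)
    (hk' : k * permDiff (fun _ => t) σ = 1) {r s : V} (hrs : r ≠ s) :
    (permDiff (fun i => if i = r ∨ i = s then 1 else t) (σ * swap r s)).det =
      (permDiff (fun _ => t) σ).det *
        (t * (k r r + k s s) - 1 - (k r s + k s r) -
          (t ^ 2 - 1) * (k r r * k s s - k r s * k s r)) := by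
  have h : permDiff (fun i => if i = r ∨ i = s then 1 else t) (σ * swap r s) =
      ((permDiff (fun _ => t) σ).updateRow r (Pi.single r 1 - Pi.single (σ s) 1)).updateRow s
        (Pi.single s 1 - Pi.single (σ r) 1) := by
    ext i j
    by_cases h1 : i = s
    · subst h1
      simp [permDiff_row]
    by_cases h2 : i = r
    · subst h2
      simp [updateRow_ne h1, permDiff_row]
    · simp [h1, h2, permDiff_row, swap_apply_of_ne_of_ne h2 h1]
  rw [h, det_updateRow_updateRow hk' hrs]
  simp only [sub_vecMul, single_one_vecMul, Pi.sub_apply, row_apply]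
  rw [inv_row_eq hk r r, inv_row_eq hk r s, inv_row_eq hk s r, inv_row_eq hk s s]
  simp only [if_true, if_neg hrs, if_neg hrs.symm]
  ring

end PermDiff

section PermCharpoly

open Matrix Equiv

variable {V : Type*} [DecidableEq V]

lemma derivative_permDiff_row (σ : Perm V) (r : V) :
    (fun j => derivative (permDiff (fun _ => (X : ℚ[X])) σ r j)) = Pi.single r 1 := by
  ext1 j
  rw [permDiff_apply, Pi.single_apply]
  by_cases h : r = j
  · split_ifs <;> simp_all
  · split_ifs <;> simp_all

variable [Fintype V]

lemma derivative_permCharpoly (σ : Perm V) :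
    derivative (permCharpoly σ) =
      ∑ r, ((permDiff (fun _ => (X : ℚ[X])) σ).updateRow r (Pi.single r 1)).det := by
  rw [permCharpoly, derivative_det]
  simp_rw [derivative_permDiff_row]

lemma derivative_derivative_permCharpoly (σ : Perm V) :
    derivative (derivative (permCharpoly σ)) =
      ∑ r, ∑ s, if r = s then 0 else
        (((permDiff (fun _ => (X : ℚ[X])) σ).updateRow r (Pi.single r 1)).updateRow s
          (Pi.single s 1)).det := by
  rw [derivative_permCharpoly, derivative_sum]
  refine Finset.sum_congr rfl fun r _ => ?_
  rw [derivative_det]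
  refine Finset.sum_congr rfl fun s _ => ?_
  split_ifs with h
  · subst h
    refine det_eq_zero_of_row_eq_zero r fun j => ?_
    rw [updateRow_self, updateRow_self, Pi.single_apply]
    split_ifs <;> simp
  · rw [updateRow_ne (Ne.symm h), derivative_permDiff_row]

/-- An inverse of `permDiff` over the field of rational functions, with the derivatives of the
characteristic polynomial expressed through it. -/
lemma exists_inv_permDiff (σ : Perm V) :
    ∃ k : Matrix V V (RatFunc ℚ),
      permDiff (fun _ => algebraMap ℚ[X] (RatFunc ℚ) X) σ * k = 1 ∧
      k * permDiff (fun _ => algebraMap ℚ[X] (RatFunc ℚ) X) σ = 1 ∧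
      algebraMap ℚ[X] (RatFunc ℚ) (derivative (permCharpoly σ)) =
        algebraMap ℚ[X] (RatFunc ℚ) (permCharpoly σ) * ∑ r, k r r ∧
      algebraMap ℚ[X] (RatFunc ℚ) (derivative (derivative (permCharpoly σ))) =
        algebraMap ℚ[X] (RatFunc ℚ) (permCharpoly σ) *
          ∑ r, ∑ s, (k r r * k s s - k r s * k s r) := by
  set φ := algebraMap ℚ[X] (RatFunc ℚ) with hφ
  set M := permDiff (fun _ => φ X) σ with hM
  have hdet : φ (permCharpoly σ) = M.det := permDiff_map φ _ σ
  have h0 : M.det ≠ 0 := by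
    rw [← hdet, Ne, FaithfulSMul.algebraMap_eq_zero_iff]
    exact (permCharpoly_monic σ).ne_zero
  have hk : M * M⁻¹ = 1 := mul_nonsing_inv _ h0.isUnit
  have hk' : M⁻¹ * M = 1 := nonsing_inv_mul _ h0.isUnit
  have hmap : (permDiff (fun _ => (X : ℚ[X])) σ).map φ = M := by
    ext i j
    simp only [hM, Matrix.map_apply, permDiff_apply]
    split_ifs <;> simp
  have hsingle (r : V) : φ ∘ (Pi.single r 1 : V → ℚ[X]) = Pi.single r 1 := by
    ext j
    rw [Function.comp_apply, Pi.single_apply, Pi.single_apply]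
    split_ifs <;> simp
  refine ⟨M⁻¹, hk, hk', ?_, ?_⟩
  · rw [derivative_permCharpoly, map_sum, hdet, Finset.mul_sum]
    refine Finset.sum_congr rfl fun r _ => ?_
    rw [RingHom.map_det, RingHom.mapMatrix_apply, map_updateRow, hmap, hsingle,
      det_updateRow_eq hk', single_one_vecMul, row_apply]
  · rw [derivative_derivative_permCharpoly, map_sum, hdet, Finset.mul_sum]
    refine Finset.sum_congr rfl fun r _ => ?_
    rw [map_sum, Finset.mul_sum]
    refine Finset.sum_congr rfl fun s _ => ?_
    split_ifs with h
    · subst h; simp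
    · rw [RingHom.map_det, RingHom.mapMatrix_apply, map_updateRow, map_updateRow, hmap, hsingle,
        hsingle, det_updateRow_updateRow hk' h, single_one_vecMul, row_apply, single_one_vecMul,
        row_apply, row_apply, row_apply]

lemma algebraMap_permCharpoly (σ : Perm V) :
    algebraMap ℚ[X] (RatFunc ℚ) (permCharpoly σ) =
      (permDiff (fun _ => algebraMap ℚ[X] (RatFunc ℚ) X) σ).det :=
  permDiff_map _ _ σ

/-- The sum over all transpositions through `u` of the characteristic polynomials. -/
lemma sum_permCharpoly_swap_mul (σ : Perm V) (u : V) :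
    (X - 1) * ∑ w, permCharpoly (swap u w * σ) =
      (Fintype.card V : ℚ[X]) * (permCharpoly (swap none (some u) * optionCongr σ) - permCharpoly σ) +
        (X - 1) * (X * derivative (permCharpoly σ) - (Fintype.card V : ℚ[X]) * permCharpoly σ) -
        2 * permCharpoly σ := by
  apply FaithfulSMul.algebraMap_injective ℚ[X] (RatFunc ℚ)
  obtain ⟨k, hk, hk', h1, -⟩ := exists_inv_permDiff σ
  have ht : algebraMap ℚ[X] (RatFunc ℚ) X ≠ 0 := by
    rw [Ne, FaithfulSMul.algebraMap_eq_zero_iff]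
    exact X_ne_zero
  have hins := det_permDiff_insert hk hk' ht u
  rw [← algebraMap_permCharpoly, ← algebraMap_permCharpoly] at hins
  simp only [map_mul, map_add, map_sub, map_one, map_natCast, map_ofNat, map_sum]
  rw [h1, hins]
  set t := algebraMap ℚ[X] (RatFunc ℚ) X
  set F := algebraMap ℚ[X] (RatFunc ℚ) (permCharpoly σ) with hF
  have hsw (w : V) : algebraMap ℚ[X] (RatFunc ℚ) (permCharpoly (swap u w * σ)) =
      F * (t * (k u u + k w w - k u w - k w u) - 1) + if u = w then 2 * F else 0 := by
    split_ifs with h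
    · subst h
      rw [swap_self, ← Perm.one_def, one_mul, ← hF]
      ring
    · rw [algebraMap_permCharpoly, det_permDiff_swap_mul hk hk' h, ← algebraMap_permCharpoly,
        add_zero]
  simp_rw [hsw]
  have hr := inv_row_sum hk' u
  have hc := inv_col_sum hk u
  simp only [Finset.sum_add_distrib, Finset.sum_sub_distrib, ← Finset.mul_sum, Finset.sum_const,
    Finset.card_univ, nsmul_eq_mul, mul_one, Finset.sum_ite_eq, Finset.mem_univ, if_true]
  linear_combination (-F * t) * (hr + hc)

/-- Ordered-pair sum for the terms without closed cycles. -/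
lemma sum_det_permDiff_two_mul_swap (σ : Perm V) :
    (X - 1) * ∑ r, ∑ s, (if r = s then 0 else
        (permDiff (fun i => if i = r ∨ i = s then 1 else (X : ℚ[X])) (σ * swap r s)).det) =
      (X - 1) * (2 * ((Fintype.card V : ℚ[X]) - 1) * X * derivative (permCharpoly σ) +
        2 * derivative (permCharpoly σ) -
          (Fintype.card V : ℚ[X]) * ((Fintype.card V : ℚ[X]) - 1) * permCharpoly σ) -
        2 * (Fintype.card V : ℚ[X]) * permCharpoly σ -
        (X - 1) ^ 2 * (X + 1) * derivative (derivative (permCharpoly σ)) := by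
  apply FaithfulSMul.algebraMap_injective ℚ[X] (RatFunc ℚ)
  obtain ⟨k, hk, hk', h1, h2⟩ := exists_inv_permDiff σ
  simp only [map_mul, map_add, map_sub, map_one, map_natCast, map_ofNat, map_sum, map_pow]
  rw [h1, h2]
  set t := algebraMap ℚ[X] (RatFunc ℚ) X with ht
  set F := algebraMap ℚ[X] (RatFunc ℚ) (permCharpoly σ) with hF
  have hf (r s : V) : algebraMap ℚ[X] (RatFunc ℚ) (if r = s then 0 else
        (permDiff (fun i => if i = r ∨ i = s then 1 else (X : ℚ[X])) (σ * swap r s)).det) =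
      F * (t * (k r r + k s s) - 1 - (k r s + k s r) -
          (t ^ 2 - 1) * (k r r * k s s - k r s * k s r)) -
        if r = s then F * (2 * t * k r r - 1 - 2 * k r r) else 0 := by
    split_ifs with h
    · subst h
      rw [map_zero]
      ring
    · rw [permDiff_map, sub_zero, hF, algebraMap_permCharpoly, ← det_permDiff_two_mul_swap hk hk' h]
      congr 2
      ext i
      split_ifs <;> simp [ht]
  simp_rw [hf]
  have hr (x : V) := inv_row_sum hk' x
  have hrr : (t - 1) * ∑ x, ∑ y, k x y = Fintype.card V := by
    rw [Finset.mul_sum, Finset.sum_congr rfl fun x _ => hr x]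
    simp
  have hcc : ∑ x, ∑ y, k y x = ∑ x, ∑ y, k x y := Finset.sum_comm
  simp only [Finset.sum_add_distrib, Finset.sum_sub_distrib, ← Finset.mul_sum, Finset.sum_const,
    Finset.card_univ, nsmul_eq_mul, mul_one, Finset.sum_ite_eq, Finset.mem_univ, if_true]
  rw [hcc]
  linear_combination (-2 * F) * hrr

lemma sum_det_permDiff_two (σ : Perm V) (hσ : ∀ r, σ r ≠ r) :
    X * ∑ r, (permDiff (fun i => if i = r ∨ i = σ r then 1 else (X : ℚ[X])) σ).det =
      (Fintype.card V : ℚ[X]) * X * permCharpoly σ - 2 * (X - 1) * X * derivative (permCharpoly σ) +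
        (X - 1) ^ 2 * derivative (permCharpoly σ) := by
  apply FaithfulSMul.algebraMap_injective ℚ[X] (RatFunc ℚ)
  obtain ⟨k, hk, hk', h1, -⟩ := exists_inv_permDiff σ
  simp only [map_mul, map_add, map_sub, map_one, map_natCast, map_ofNat, map_sum, map_pow]
  rw [h1, Finset.mul_sum]
  set t := algebraMap ℚ[X] (RatFunc ℚ) X with ht
  set F := algebraMap ℚ[X] (RatFunc ℚ) (permCharpoly σ) with hF
  have hg (r : V) : t * algebraMap ℚ[X] (RatFunc ℚ)
        (permDiff (fun i => if i = r ∨ i = σ r then 1 else (X : ℚ[X])) σ).det =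
      F * (t - (t - 1) * t * (k r r + k (σ r) (σ r)) + (t - 1) ^ 2 * k (σ r) (σ r)) := by
    have e : (permDiff (fun i => algebraMap ℚ[X] (RatFunc ℚ) (if i = r ∨ i = σ r then 1 else X))
        σ).det = (permDiff (fun i => if i = r ∨ i = σ r then 1 else t) σ).det := by
      congr 2
      ext i
      split_ifs <;> simp [ht]
    rw [permDiff_map, e, det_permDiff_two hk hk' (hσ r).symm, ← algebraMap_permCharpoly, ← hF,
      inv_row_eq hk r r, inv_row_eq hk r (σ r), if_pos rfl, if_neg (hσ r).symm]
    ring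
  have hc : ∑ r, k (σ r) (σ r) = ∑ r, k r r := Equiv.sum_comp σ fun r => k r r
  simp_rw [hg]
  simp only [Finset.sum_add_distrib, Finset.sum_sub_distrib, ← Finset.mul_sum, Finset.sum_const,
    Finset.card_univ, nsmul_eq_mul, hc]
  ring

end PermCharpoly

section CycleCount

open Equiv

variable {V W : Type*} [Fintype V] [DecidableEq V] [Fintype W] [DecidableEq W]

/-- The number of cycles of a permutation of a finite type, fixed points included. -/
def cycleCount (σ : Perm V) : ℕ :=
  Multiset.card σ.cycleType + (Fintype.card V - σ.cycleType.sum)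

lemma cycleCount_pos [Nonempty V] (σ : Perm V) : 0 < cycleCount σ := by
  rw [cycleCount]
  rcases Nat.eq_zero_or_pos (Multiset.card σ.cycleType) with h | h
  · rw [Multiset.card_eq_zero.1 h]
    simpa using Fintype.card_pos
  · omega

lemma cycleType_permCongr (e : V ≃ W) (σ : Perm V) :
    (e.permCongr σ).cycleType = σ.cycleType := by
  let f : V ≃ {w : W // True} := e.trans (Equiv.Set.univ W).symm
  have h : e.permCongr σ = σ.extendDomain f := by
    ext w
    rw [Perm.extendDomain_apply_subtype _ _ trivial]
    rfl
  rw [h, Perm.cycleType_extendDomain]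

lemma cycleType_optionCongr (τ : Perm V) : Perm.cycleType (optionCongr τ) = τ.cycleType := by
  have h : (optionCongr τ : Perm (Option V)) =
      τ.extendDomain (optionIsSomeEquiv V).symm := by
    ext1 x
    rcases x with _ | x
    · rw [Perm.extendDomain_apply_not_subtype _ _ (by simp)]
      rfl
    · rw [Perm.extendDomain_apply_subtype _ _ (by simp)]
      simp [optionIsSomeEquiv]
  rw [h, Perm.cycleType_extendDomain]

lemma cycleCount_permCongr (e : V ≃ W) (σ : Perm V) :
    cycleCount (e.permCongr σ) = cycleCount σ := by
  rw [cycleCount, cycleCount, cycleType_permCongr, Fintype.card_congr e]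

lemma cycleCount_mul_comm (σ τ : Perm V) : cycleCount (σ * τ) = cycleCount (τ * σ) := by
  have h : σ * τ = σ * (τ * σ) * σ⁻¹ := by group
  rw [cycleCount, h, Perm.cycleType_conj, cycleCount]

lemma sum_cycleType_le (σ : Perm V) : σ.cycleType.sum ≤ Fintype.card V := by
  rw [Perm.sum_cycleType]
  exact Finset.card_le_univ _

lemma cycleCount_optionCongr (τ : Perm V) :
    cycleCount (optionCongr τ) = cycleCount τ + 1 := by
  have := sum_cycleType_le τ
  rw [cycleCount, cycleCount, cycleType_optionCongr, Fintype.card_option]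
  omega

/-- Splitting a moved point off its cycle. -/
lemma cycleCount_swap_mul {σ : Perm V} {x : V} (hx : σ x ≠ x) :
    cycleCount (swap x (σ x) * σ) = cycleCount σ + 1 := by
  set c := σ.cycleOf x with hc
  have hcyc : c.IsCycle := Perm.isCycle_cycleOf σ hx
  have hmem : c ∈ σ.cycleFactorsFinset :=
    Perm.cycleOf_mem_cycleFactorsFinset_iff.2 (Perm.mem_support.2 hx)
  have hcx : c x = σ x := Perm.cycleOf_apply_self σ x
  set r := σ * c⁻¹ with hr
  have hdis : Perm.Disjoint c r := (Perm.disjoint_mul_inv_of_mem_cycleFactorsFinset hmem).symm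
  have hσ : σ = c * r := by rw [hdis.commute.eq, hr]; group
  have hle := sum_cycleType_le σ
  have hsw : swap x (σ x) * σ = (swap x (c x) * c) * r := by rw [hcx, mul_assoc, ← hσ]
  have hx' : c x ≠ x := by rwa [hcx]
  have hct : σ.cycleType = {c.support.card} + r.cycleType := by
    conv_lhs => rw [hσ]
    rw [hdis.cycleType_mul, hcyc.cycleType]
  by_cases h2 : c (c x) = x
  · have hs : c = swap x (c x) := hcyc.eq_swap_of_apply_apply_eq_self hx' h2
    have h1 : swap x (c x) * c = 1 := by
      conv_lhs => rw [hs]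
      simp
    have hcard : c.support.card = 2 := by
      rw [hs]
      exact Perm.card_support_swap hx'.symm
    rw [hsw, h1, one_mul, cycleCount, cycleCount]
    rw [hct, hcard] at hle ⊢
    simp only [Multiset.sum_add, Multiset.sum_singleton, Multiset.card_add,
      Multiset.card_singleton] at hle ⊢
    omega
  · have hsupp := Perm.support_swap_mul_eq c x h2
    have hdis' : Perm.Disjoint (swap x (c x) * c) r := by
      refine hdis.mono ?_ le_rfl
      rw [hsupp]
      exact Finset.sdiff_subset
    have hcard : (swap x (c x) * c).support.card + 1 = c.support.card := by
      rw [hsupp, Finset.sdiff_singleton_eq_erase,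
        Finset.card_erase_add_one (Perm.mem_support.2 hx')]
    rw [hsw, cycleCount, cycleCount, hdis'.cycleType_mul, (hcyc.swap_mul hx' h2).cycleType]
    rw [hct, ← hcard] at hle ⊢
    simp only [Multiset.sum_add, Multiset.sum_singleton, Multiset.card_add,
      Multiset.card_singleton] at hle ⊢
    omega

lemma cycleCount_removeNone (σ : Perm (Option V)) :
    cycleCount σ = cycleCount (removeNone σ) + if σ none = none then 1 else 0 := by
  have h := map_equiv_removeNone σ
  have h' := cycleCount_optionCongr (removeNone σ)
  rw [h] at h'
  split_ifs with h0
  · rwa [h0, swap_self, ← Perm.one_def, one_mul] at h'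
  · rw [cycleCount_swap_mul h0] at h'
    omega

lemma removeNone_mul_optionCongr {U : Type*} (π : Perm (Option U)) (ρ : Perm U) :
    removeNone (π * optionCongr ρ) = removeNone π * ρ := by
  ext i
  rw [removeNone_eq_iff]
  simpa using (removeNone_eq_iff π (ρ i) _).1 rfl

lemma removeNone_swap_mul_optionCongr {U : Type*} [DecidableEq U] (i : Option U) (ρ : Perm U) :
    removeNone (swap none i * optionCongr ρ) = ρ := by
  have := Perm.decomposeOption.apply_symm_apply (i, ρ)
  exact (Prod.ext_iff.1 this).2

/-- The generating function of the cycle numbers of `σ * α`, over all full cycles `α`. -/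
def fullCycleSum (q : ℚ) (σ : Perm V) : ℚ :=
  ∑ α : Perm V, if cycleCount α = 1 then q ^ cycleCount (σ * α) else 0

lemma sum_perm_option (f : Perm (Option V) → ℚ) :
    ∑ α, f α = ∑ i : Option V, ∑ τ : Perm V, f (swap none i * optionCongr τ) := by
  rw [← Fintype.sum_prod_type', ← Equiv.sum_comp Perm.decomposeOption.symm]
  rfl

lemma fullCycleSum_option [Nonempty V] (q : ℚ) (σ : Perm (Option V)) :
    fullCycleSum q σ = ∑ s : V, q ^ (if σ (some s) = none then 1 else 0) *
      fullCycleSum q (removeNone (σ * swap none (some s))) := by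
  rw [fullCycleSum, sum_perm_option, Fintype.sum_option]
  have h0 : ∑ τ : Perm V, (if cycleCount (swap none none * optionCongr τ) = 1 then
      q ^ cycleCount (σ * (swap none none * optionCongr τ)) else 0) = 0 := by
    refine Finset.sum_eq_zero fun τ _ => if_neg ?_
    rw [swap_self, ← Perm.one_def, one_mul, cycleCount_optionCongr]
    have := cycleCount_pos τ
    omega
  rw [h0, zero_add]
  refine Finset.sum_congr rfl fun s _ => ?_
  rw [fullCycleSum, Finset.mul_sum]
  refine Finset.sum_congr rfl fun τ _ => ?_
  have h1 : cycleCount (swap none (some s) * optionCongr τ) = cycleCount τ := by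
    rw [cycleCount_removeNone, removeNone_swap_mul_optionCongr]
    simp
  rw [h1, mul_ite, mul_zero]
  congr 1
  rw [← mul_assoc, cycleCount_removeNone, removeNone_mul_optionCongr, pow_add, mul_comm]
  congr 2

lemma fullCycleSum_optionCongr [Nonempty V] (q : ℚ) (τ : Perm V) :
    fullCycleSum q (optionCongr τ) = Fintype.card V * fullCycleSum q τ := by
  rw [fullCycleSum_option, Finset.sum_congr rfl (g := fun _ => fullCycleSum q τ)]
  · simp
  intro s _
  have h : removeNone (optionCongr τ * swap none (some s)) = τ := by
    ext i
    rw [removeNone_eq_iff]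
    by_cases h : i = s
    · subst h; simp
    · left
      rw [Perm.mul_apply, swap_apply_of_ne_of_ne (by simp) (by simpa using h)]
      simp
  rw [h]
  simp

lemma fullCycleSum_swap_mul_optionCongr [Nonempty V] (q : ℚ) (τ : Perm V) (u : V) :
    fullCycleSum q (swap none (some u) * optionCongr τ) =
      ∑ w, q ^ (if w = u then 1 else 0) * fullCycleSum q (swap u w * τ) := by
  rw [fullCycleSum_option]
  refine Eq.trans ?_ (Equiv.sum_comp τ
    fun w => q ^ (if w = u then 1 else 0) * fullCycleSum q (swap u w * τ))
  refine Finset.sum_congr rfl fun s _ => ?_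
  have h1 : (swap none (some u) * optionCongr τ) (some s) = none ↔ τ s = u := by
    rw [Perm.mul_apply, swap_apply_eq_iff]
    simp
  have h2 : removeNone (swap none (some u) * optionCongr τ * swap none (some s)) =
      swap u (τ s) * τ := by
    ext i
    rw [removeNone_eq_iff]
    by_cases h : i = s
    · subst h
      left
      simp
    · have h3 : swap none (some s) (some i) = some i :=
        swap_apply_of_ne_of_ne (by simp) (by simpa using h)
      have h4 : τ i ≠ τ s := by simpa using h
      by_cases h5 : τ i = u
      · right
        subst h5
        simp only [Perm.mul_apply, h3, optionCongr_apply, Option.map_some, swap_apply_left,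
          swap_apply_right, true_and]
        exact swap_apply_of_ne_of_ne (by simp) (by simpa using h4.symm)
      · left
        simp only [Perm.mul_apply, h3, optionCongr_apply, Option.map_some]
        rw [swap_apply_of_ne_of_ne (by simp) (by simpa using h5), swap_apply_of_ne_of_ne h5 h4]
  rw [h2]
  congr 2
  simp only [h1]

lemma fullCycleSum_permCongr (q : ℚ) (e : V ≃ W) (σ : Perm V) :
    fullCycleSum q (e.permCongr σ) = fullCycleSum q σ := by
  rw [fullCycleSum, fullCycleSum, ← Equiv.sum_comp e.permCongr]
  refine Finset.sum_congr rfl fun α _ => ?_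
  have h : e.permCongr σ * e.permCongr α = e.permCongr (σ * α) := by
    ext x; simp
  rw [cycleCount_permCongr, h, cycleCount_permCongr]

lemma permCharpoly_permCongr (e : V ≃ W) (σ : Perm V) :
    permCharpoly (e.permCongr σ) = permCharpoly σ :=
  det_permDiff_const e _ σ

lemma permCharpoly_optionCongr (τ : Perm V) :
    permCharpoly (optionCongr τ) = (X - 1) * permCharpoly τ := by
  apply FaithfulSMul.algebraMap_injective ℚ[X] (RatFunc ℚ)
  have hX : algebraMap ℚ[X] (RatFunc ℚ) X - 1 ≠ 0 := by
    rw [← map_one (algebraMap ℚ[X] (RatFunc ℚ)), ← map_sub, Ne,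
      FaithfulSMul.algebraMap_eq_zero_iff]
    exact X_sub_C_ne_zero (1 : ℚ)
  rw [map_mul, algebraMap_permCharpoly, algebraMap_permCharpoly,
    det_permDiff_option_fixed (mul_inv_cancel₀ hX) (by simp), removeNone_optionCongr, map_sub,
    map_one]

lemma fullCycleSum_eq_option [Nonempty V] (q : ℚ)
    (ih : ∀ τ : Perm V, (Fintype.card V * (Fintype.card V + 1) : ℚ) * fullCycleSum q τ =
      fallEval q (Fintype.card V + 1) (permCharpoly τ)) (σ : Perm (Option V)) :
    ((Fintype.card V + 1) * (Fintype.card V + 2) : ℚ) * fullCycleSum q σ =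
      fallEval q (Fintype.card V + 2) (permCharpoly σ) := by
  have hm : (Fintype.card V : ℚ) ≠ 0 := by exact_mod_cast Fintype.card_ne_zero
  have hσ : σ = swap none (σ none) * optionCongr (removeNone σ) := by
    rw [map_equiv_removeNone, ← mul_assoc, swap_mul_self, one_mul]
  rcases h : σ none with _ | u
  · rw [h, swap_self, ← Perm.one_def, one_mul] at hσ
    rw [hσ, fullCycleSum_optionCongr, permCharpoly_optionCongr, fallEval_X_sub_one_mul, ← ih]
    push_cast
    ring
  · rw [h] at hσ
    set τ := removeNone σ
    have hS : fullCycleSum q σ =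
        ∑ w, fullCycleSum q (swap u w * τ) + (q - 1) * fullCycleSum q τ := by
      rw [hσ, fullCycleSum_swap_mul_optionCongr]
      have h1 : ∀ w, q ^ (if w = u then 1 else 0) * fullCycleSum q (swap u w * τ) =
          fullCycleSum q (swap u w * τ) +
            if w = u then (q - 1) * fullCycleSum q (swap u w * τ) else 0 := by
        intro w
        split_ifs <;> ring
      rw [Finset.sum_congr rfl fun w _ => h1 w, Finset.sum_add_distrib, Finset.sum_ite_eq']
      simp [swap_self, ← Perm.one_def]
    have key := congrArg (fallEval q (Fintype.card V + 2)) (sum_permCharpoly_swap_mul τ u)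
    have hcard : ((Fintype.card V : ℕ) : ℚ[X]) = C (Fintype.card V : ℚ) := by simp
    have htwo : (2 : ℚ[X]) = C 2 := rfl
    have hsucc := fallEval_succ q (Fintype.card V + 1) (permCharpoly τ)
    rw [← hσ, hcard, htwo] at key
    simp only [map_add, map_sub, fallEval_X_sub_one_mul, fallEval_C_mul, map_sum, ← ih] at key
    rw [map_add, fallEval_C_mul, ← ih] at hsucc
    rw [← Finset.mul_sum] at key
    rw [hS]
    refine mul_left_cancel₀ hm ?_
    push_cast at key hsucc
    linear_combination key - (Fintype.card V + 2 : ℚ) * hsucc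

/-- Stanley formula for the cycle numbers of products with full cycles. -/
theorem fullCycleSum_eq (q : ℚ) [Nonempty V] (σ : Perm V) :
    (Fintype.card V * (Fintype.card V + 1) : ℚ) * fullCycleSum q σ =
      fallEval q (Fintype.card V + 1) (permCharpoly σ) := by
  have hss : Subsingleton (Perm (Fin (0 + 1))) := inferInstanceAs (Subsingleton (Perm (Fin 1)))
  have hfin : ∀ (m : ℕ) (σ : Perm (Fin (m + 1))),
      ((m + 1) * (m + 2) : ℚ) * fullCycleSum q σ = fallEval q (m + 2) (permCharpoly σ) := by
    intro m
    induction m with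
    | zero =>
      intro σ
      have h1 : fullCycleSum q σ = q := by
        have : ∀ τ : Perm (Fin (0 + 1)), cycleCount τ = 1 := fun τ => by
          rw [Subsingleton.elim τ 1]
          simp [cycleCount]
        simp [fullCycleSum, this]
      have h2 : permCharpoly σ = (X - 1) * 1 := by
        rw [permCharpoly, Matrix.det_fin_one, permDiff_apply]
        simp [Subsingleton.elim σ 1]
      rw [h1, h2, fallEval_X_sub_one_mul, fallEval_one]
      norm_num
    | succ m ih =>
      intro σ
      rw [← fullCycleSum_permCongr q (finSuccEquiv (m + 1)) σ,
        ← permCharpoly_permCongr (finSuccEquiv (m + 1)) σ]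
      have := fullCycleSum_eq_option q (fun τ => by
        rw [Fintype.card_fin, ← ih τ]; push_cast; ring) ((finSuccEquiv (m + 1)).permCongr σ)
      rw [Fintype.card_fin] at this
      rw [← this]
  obtain ⟨m, hm⟩ : ∃ m, Fintype.card V = m + 1 :=
    Nat.exists_eq_succ_of_ne_zero Fintype.card_ne_zero
  have e := Fintype.equivFinOfCardEq hm
  rw [← fullCycleSum_permCongr q e, ← permCharpoly_permCongr e, hm, ← hfin]
  push_cast
  ring

end CycleCount

section CycleType

open Equiv

variable {V : Type*} [Fintype V] [DecidableEq V]

lemma eq_one_or_eq_inv_of_isCycle {c π : Perm V} (hc : c.IsCycle)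
    (h : ∀ i, π i = i ∨ π i = c⁻¹ i) : π = 1 ∨ π = c⁻¹ := by
  by_cases h1 : ∀ i, π i = i
  · exact Or.inl (Perm.ext h1)
  right
  push Not at h1
  obtain ⟨x, hx⟩ := h1
  have hx' : π x = c⁻¹ x := (h x).resolve_left hx
  have hmove : c⁻¹ x ≠ x := hx' ▸ hx
  have hpow (k : ℕ) : π (((c⁻¹) ^ k) x) = c⁻¹ (((c⁻¹) ^ k) x) := by
    induction k with
    | zero => simpa using hx'
    | succ k ih =>
      rw [pow_succ', Perm.mul_apply]
      refine (h _).resolve_left fun h2 => ?_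
      rw [← ih] at h2
      have h3 := π.injective h2
      rw [ih, ← Perm.mul_apply, ← pow_succ', pow_succ, Perm.mul_apply] at h3
      exact hmove (((c⁻¹) ^ k).injective h3)
  ext i
  by_cases hi : c⁻¹ i = i
  · rcases h i with h' | h'
    · rw [h', hi]
    · exact h'
  · obtain ⟨k, -, hk⟩ := (hc.inv.sameCycle hmove hi).exists_pow_eq'
    rw [← hk]
    exact hpow k

lemma permCharpoly_isCycle {c : Perm V} (hc : c.IsCycle) :
    (X - 1) ^ c.support.card * permCharpoly c =
      (X - 1) ^ Fintype.card V * (X ^ c.support.card - 1) := by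
  have hne : (1 : Perm V) ≠ c⁻¹ := fun h => hc.ne_one (inv_eq_one.1 h.symm)
  have hle : c.support.card ≤ Fintype.card V := Finset.card_le_univ _
  have hcompl : c.supportᶜ.card = Fintype.card V - c.support.card := Finset.card_compl _
  have hprod (u v : ℚ[X]) : ∏ i, (if c i = i then u else v) =
      u ^ (Fintype.card V - c.support.card) * v ^ c.support.card := by
    rw [Finset.prod_ite, Finset.prod_const, Finset.prod_const, ← hcompl]
    congr 3
    ext i; simp
  have h1 : ∏ i, permDiff (fun _ => (X : ℚ[X])) c ((1 : Perm V) i) i =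
      (X - 1) ^ (Fintype.card V - c.support.card) * X ^ c.support.card := by
    rw [← hprod]
    refine Finset.prod_congr rfl fun i _ => ?_
    rw [permDiff_apply]
    split_ifs <;> simp_all
  have h2 : ∏ i, permDiff (fun _ => (X : ℚ[X])) c (c⁻¹ i) i =
      (X - 1) ^ (Fintype.card V - c.support.card) * (-1) ^ c.support.card := by
    rw [← hprod]
    refine Finset.prod_congr rfl fun i _ => ?_
    have : c⁻¹ i = i ↔ c i = i := by rw [Perm.inv_eq_iff_eq, eq_comm]
    rw [permDiff_apply]
    split_ifs <;> simp_all
  have hdet : permCharpoly c =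
      (X - 1) ^ (Fintype.card V - c.support.card) * (X ^ c.support.card - 1) := by
    rw [permCharpoly, Matrix.det_apply', ← Finset.sum_subset (Finset.subset_univ {1, c⁻¹}),
      Finset.sum_pair hne, h1, h2, Perm.sign_inv, hc.sign]
    · have : ((-1 : ℚ[X]) ^ c.support.card) * (-1) ^ c.support.card = 1 := by
        rw [← mul_pow]; simp
      push_cast
      rw [Perm.sign_one]
      push_cast
      linear_combination (-(X - 1) ^ (Fintype.card V - c.support.card) : ℚ[X]) * this
    · intro π _ hπ
      by_contra h0
      refine hπ ?_
      rw [Finset.mem_insert, Finset.mem_singleton]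
      refine eq_one_or_eq_inv_of_isCycle hc fun i => ?_
      by_contra h3
      push Not at h3
      refine h0 (mul_eq_zero_of_right _ (Finset.prod_eq_zero (Finset.mem_univ i) ?_))
      have h4 : c (π i) ≠ i := fun h => h3.2 (by rw [Perm.eq_inv_iff_eq, h])
      rw [permDiff_apply, if_neg h3.1, if_neg h4, sub_zero]
  rw [hdet, ← mul_assoc, ← pow_add, Nat.add_sub_cancel' hle]

lemma permDiff_mul_of_disjoint {R : Type*} [CommRing R] {σ τ : Perm V} (h : σ.Disjoint τ) (t : R) :
    permDiff (fun _ => t) σ * permDiff (fun _ => t) τ =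
      (t - 1) • permDiff (fun _ => t) (σ * τ) := by
  ext i j
  rw [Matrix.mul_apply]
  simp only [permDiff_apply, sub_mul, ite_mul, zero_mul, one_mul, Finset.sum_sub_distrib,
    Finset.sum_ite_eq, Finset.mem_univ, if_true, Matrix.smul_apply, smul_eq_mul]
  have hcomm : σ (τ i) = τ (σ i) := by
    rw [← Perm.mul_apply, h.commute.eq, Perm.mul_apply]
  rcases h i with h1 | h1
  · rw [Perm.mul_apply, hcomm, h1]
  · rw [Perm.mul_apply, ← hcomm, h1]
    split_ifs <;> ring

lemma permCharpoly_mul_of_disjoint {σ τ : Perm V} (h : σ.Disjoint τ) :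
    permCharpoly σ * permCharpoly τ = (X - 1) ^ Fintype.card V * permCharpoly (σ * τ) := by
  rw [permCharpoly, permCharpoly, ← Matrix.det_mul, permDiff_mul_of_disjoint h, Matrix.det_smul,
    permCharpoly]

lemma X_sub_one_pow_ne_zero (k : ℕ) : ((X : ℚ[X]) - 1) ^ k ≠ 0 :=
  pow_ne_zero _ (X_sub_C_ne_zero (1 : ℚ))

/-- The characteristic polynomial of a permutation in terms of its cycle type. -/
lemma permCharpoly_cycleType (σ : Perm V) :
    (X - 1) ^ σ.cycleType.sum * permCharpoly σ =
      (X - 1) ^ Fintype.card V * (σ.cycleType.map fun k => (X : ℚ[X]) ^ k - 1).prod := by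
  induction σ using Perm.cycle_induction_on with
  | base_one =>
    have h : permDiff (fun _ => (X : ℚ[X])) (1 : Perm V) = (X - 1 : ℚ[X]) • 1 := by
      ext1 i j
      by_cases hij : i = j <;> simp [permDiff_apply, hij]
    rw [permCharpoly, h, Matrix.det_smul]
    simp
  | base_cycles c hc =>
    rw [hc.cycleType]
    simpa using permCharpoly_isCycle hc
  | induction_disjoint σ τ hd _ ihσ ihτ =>
    rw [hd.cycleType_mul, Multiset.sum_add, Multiset.map_add, Multiset.prod_add, pow_add]
    refine mul_left_cancel₀ (X_sub_one_pow_ne_zero (Fintype.card V)) ?_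
    have := permCharpoly_mul_of_disjoint hd
    linear_combination (-(X - 1) ^ σ.cycleType.sum * (X - 1) ^ τ.cycleType.sum : ℚ[X]) * this +
      ((X - 1) ^ τ.cycleType.sum * permCharpoly τ) * ihσ +
      ((X - 1) ^ Fintype.card V * (σ.cycleType.map fun k => (X : ℚ[X]) ^ k - 1).prod) * ihτ

lemma permCharpoly_of_sum_eq {σ : Perm V} (h : σ.cycleType.sum = Fintype.card V) :
    permCharpoly σ = (σ.cycleType.map fun k => (X : ℚ[X]) ^ k - 1).prod := by
  have := permCharpoly_cycleType σ
  rw [h] at this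
  exact mul_left_cancel₀ (X_sub_one_pow_ne_zero _) this

lemma apply_ne_of_sum_eq {σ : Perm V} (h : σ.cycleType.sum = Fintype.card V) (x : V) :
    σ x ≠ x := by
  rw [Perm.sum_cycleType, Finset.card_eq_iff_eq_univ] at h
  rw [← Perm.mem_support, h]
  exact Finset.mem_univ x

lemma apply_apply_ne {σ : Perm V} (h : σ.cycleType.sum = Fintype.card V)
    (h3 : ∀ k ∈ σ.cycleType, 3 ≤ k) (x : V) : σ (σ x) ≠ x := by
  intro h2
  have hx := apply_ne_of_sum_eq h x
  have hmem : σ.cycleOf x ∈ σ.cycleFactorsFinset :=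
    Perm.cycleOf_mem_cycleFactorsFinset_iff.2 (Perm.mem_support.2 hx)
  have hs : σ.cycleOf x = swap x (σ.cycleOf x x) := by
    refine (Perm.isCycle_cycleOf σ hx).eq_swap_of_apply_apply_eq_self ?_ ?_
    · rwa [Perm.cycleOf_apply_self]
    · rw [Perm.cycleOf_apply_self, Perm.cycleOf_apply_apply_self, h2]
  have hcard : (σ.cycleOf x).support.card = 2 := by
    rw [hs, Perm.cycleOf_apply_self]
    exact Perm.card_support_swap hx.symm
  have := h3 2 (by
    rw [Perm.cycleType_def]
    exact Multiset.mem_map.2 ⟨_, hmem, hcard⟩)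
  omega

end CycleType

section TwoCycle

open Equiv

variable {V : Type*} [DecidableEq V]

lemma cycleCount_mul_optionCongr_optionCongr [Fintype V] (π : Perm (Option (Option V)))
    (ρ : Perm V) :
    cycleCount (π * optionCongr (optionCongr ρ)) = cycleCount (removeNone (removeNone π) * ρ) +
      ((if removeNone π none = none then 1 else 0) + if π none = none then 1 else 0) := by
  rw [cycleCount_removeNone, cycleCount_removeNone, removeNone_mul_optionCongr,
    removeNone_mul_optionCongr, add_assoc]
  rfl

variable {ω : Perm (Option (Option V))}

lemma mul_swap_none_eq_none :
    (ω * swap none (some none) : Perm (Option (Option V))) none = none ↔ ω (some none) = none := by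
  rw [Perm.mul_apply, swap_apply_left]

lemma removeNone_mul_swap_none_eq_none (hω : ∀ x, ω x ≠ x) :
    removeNone (ω * swap none (some none) : Perm (Option (Option V))) none = none ↔ ω none = some none := by
  rw [removeNone_eq_iff, Perm.mul_apply, swap_apply_right]
  exact or_iff_left fun h => hω _ h.1

lemma removeNone_removeNone_mul_swap (hω : ∀ x, ω x ≠ x) (hω2 : ∀ x, ω (ω x) ≠ x)
    (h : ω none = some none ∨ ω (some none) = none) :
    removeNone (removeNone (ω * swap none (some none))) = removeNone (removeNone ω) := by
  have hsw (w : V) : (ω * swap none (some none) : Perm (Option (Option V))) (some (some w)) = ω (some (some w)) := by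
    rw [Perm.mul_apply, swap_apply_of_ne_of_ne (by simp) (by simp)]
  have hl : (ω * swap none (some none) : Perm (Option (Option V))) none = ω (some none) := by simp
  have hr : (ω * swap none (some none) : Perm (Option (Option V))) (some none) = ω none := by simp
  ext i
  rw [removeNone_eq_iff]
  have key := (removeNone_eq_iff (removeNone ω) i _).1 rfl
  set j := removeNone (removeNone ω) i
  simp only [removeNone_eq_iff, hsw, hl, hr] at key ⊢
  have hi : ω (some none) = none → ω (some (some i)) ≠ none := fun h1 h2 => by
    have := ω.injective (h1.trans h2.symm)
    simp at this
  have hi' : ω none = some none → ω (some (some i)) ≠ some none := fun h1 h2 => by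
    have := ω.injective (h1.trans h2.symm)
    simp at this
  have h1 := hω none
  have h2 := hω (some none)
  have h3 := hω2 none
  have h4 := hω2 (some none)
  grind

variable [Fintype V]

/-- The polynomial summand for the ordered pair `(r, s)` attached to a permutation. -/
noncomputable def pairPoly {U : Type*} [Fintype U] [DecidableEq U] (q : ℚ) (ω : Perm U)
    (r s : U) : ℚ[X] :=
  (permDiff (fun i => if i = r ∨ i = s then 1 else (X : ℚ[X])) (ω * swap r s)).det +
    if ω r = s ∨ ω s = r then
      C q * (permDiff (fun i => if i = r ∨ i = s then 1 else (X : ℚ[X])) ω).det else 0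

lemma det_permDiff_option_option {ρ : Perm (Option (Option V))} (h1 : ρ none ≠ none)
    (h2 : removeNone ρ none ≠ none) :
    (permDiff (fun i => if i = none ∨ i = some none then 1 else (X : ℚ[X])) ρ).det =
      permCharpoly (removeNone (removeNone ρ)) := by
  rw [det_permDiff_option (by simp) h1, det_permDiff_option (by simp) h2, permCharpoly]
  simp

lemma pairPoly_none (q : ℚ) (hω : ∀ x, ω x ≠ x) (hω2 : ∀ x, ω (ω x) ≠ x) :
    pairPoly q ω none (some none) =
      C (q ^ ((if removeNone (ω * swap none (some none) : Perm (Option (Option V))) none = none then 1 else 0) +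
          if (ω * swap none (some none) : Perm (Option (Option V))) none = none then 1 else 0)) *
        permCharpoly (removeNone (removeNone (ω * swap none (some none)))) := by
  by_cases h : ω none = some none ∨ ω (some none) = none
  · have hg : (permDiff (fun i => if i = none ∨ i = some none then 1 else (X : ℚ[X])) ω).det =
        permCharpoly (removeNone (removeNone ω)) := by
      refine det_permDiff_option_option (hω none) fun h' => ?_
      rcases (removeNone_eq_iff _ _ _).1 h' with h1 | h1
      · exact hω _ h1
      · exact hω2 none (by rw [h1.2, h1.1])
    have hf : (permDiff (fun i => if i = none ∨ i = some none then 1 else (X : ℚ[X]))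
        (ω * swap none (some none))).det = 0 := by
      by_cases h1 : (ω * swap none (some none) : Perm (Option (Option V))) none = none
      · exact det_permDiff_option_eq_zero (by simp) h1
      · rw [det_permDiff_option (by simp) h1]
        refine det_permDiff_option_eq_zero (by simp) ?_
        rw [removeNone_mul_swap_none_eq_none hω]
        exact h.resolve_right (mul_swap_none_eq_none.not.1 h1)
    rw [pairPoly, if_pos h, hf, hg, zero_add, removeNone_removeNone_mul_swap hω hω2 h]
    congr 2
    simp only [removeNone_mul_swap_none_eq_none hω, mul_swap_none_eq_none]
    rcases h with h | h
    · have : ω (some none) ≠ none := fun h' => hω2 none (by rw [h, h'])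
      simp [h, this]
    · have : ω none ≠ some none := fun h' => hω2 none (by rw [h', h])
      simp [h, this]
  · have h' := not_or.1 h
    have h1 := mul_swap_none_eq_none.not.2 h'.2
    have h2 := (removeNone_mul_swap_none_eq_none hω).not.2 h'.1
    rw [pairPoly, if_neg h, add_zero, det_permDiff_option_option h1 h2, if_neg h1, if_neg h2]
    simp

end TwoCycle

section Averaging

open Equiv

variable {V : Type*} [Fintype V] [DecidableEq V]

lemma exists_perm_apply_pair {U : Type*} [DecidableEq U] {r₀ s₀ r s : U} (h₀ : r₀ ≠ s₀) (h : r ≠ s) :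
    ∃ g : Perm U, g r₀ = r ∧ g s₀ = s := by
  refine ⟨swap (swap r₀ r s₀) s * swap r₀ r, ?_, ?_⟩
  · rw [Perm.mul_apply, swap_apply_left]
    refine swap_apply_of_ne_of_ne (fun h' => ?_) h
    rw [eq_comm, swap_apply_eq_iff, swap_apply_right] at h'
    exact h₀ h'.symm
  · rw [Perm.mul_apply, swap_apply_left]

lemma pairPoly_permCongr (q : ℚ) (g ω : Perm V) (r s : V) :
    pairPoly q (g.permCongr ω) (g r) (g s) = pairPoly q ω r s := by
  have h : g.permCongr ω * swap (g r) (g s) = g.permCongr (ω * swap r s) := by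
    ext x
    simp only [Perm.mul_apply, permCongr_apply, swap_apply_def, symm_apply_eq]
    split_ifs <;> simp
  rw [pairPoly, h, det_permDiff_const, det_permDiff_const]
  simp [pairPoly]

lemma sum_pairPoly_eq (q : ℚ) (β : Multiset ℕ) {r₀ s₀ r s : V} (h₀ : r₀ ≠ s₀) (h : r ≠ s) :
    ∑ ω : Perm V with ω.cycleType = β, pairPoly q ω r s =
      ∑ ω : Perm V with ω.cycleType = β, pairPoly q ω r₀ s₀ := by
  obtain ⟨g, rfl, rfl⟩ := exists_perm_apply_pair h₀ h
  rw [Finset.sum_filter, Finset.sum_filter, ← Equiv.sum_comp g.permCongr]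
  simp only [cycleType_permCongr, pairPoly_permCongr]

lemma sum_sum_pairPoly (q : ℚ) (β : Multiset ℕ) {r₀ s₀ : V} (h₀ : r₀ ≠ s₀) :
    ∑ ω : Perm V with ω.cycleType = β, ∑ r, ∑ s, (if r = s then 0 else pairPoly q ω r s) =
      ((Fintype.card V : ℚ[X]) * ((Fintype.card V : ℚ[X]) - 1)) *
        ∑ ω : Perm V with ω.cycleType = β, pairPoly q ω r₀ s₀ := by
  rw [Finset.sum_comm]
  set A := ∑ ω : Perm V with ω.cycleType = β, pairPoly q ω r₀ s₀
  have h (r s : V) : ∑ ω : Perm V with ω.cycleType = β,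
      (if r = s then 0 else pairPoly q ω r s) = A - if r = s then A else 0 := by
    split_ifs with hrs
    · simp
    · rw [sum_pairPoly_eq q β h₀ hrs, sub_zero]
  have h' (r : V) : ∑ ω : Perm V with ω.cycleType = β, ∑ s,
      (if r = s then 0 else pairPoly q ω r s) = (Fintype.card V : ℚ[X]) * A - A := by
    rw [Finset.sum_comm, Finset.sum_congr rfl fun s _ => h r s]
    simp
  rw [Finset.sum_congr rfl fun r _ => h' r]
  simp
  ring

lemma fallEval_sum_pairPoly (q : ℚ) {m : ℕ} (hm : Fintype.card V = m + 1) {ω : Perm V}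
    (hω : ∀ x, ω x ≠ x) (hω2 : ∀ x, ω (ω x) ≠ x) :
    fallEval q m (∑ r, ∑ s, (if r = s then 0 else pairPoly q ω r s)) =
      hookFunctional q (m + 1) (permCharpoly ω) := by
  set f : V → V → ℚ[X] := fun r s =>
    (permDiff (fun i => if i = r ∨ i = s then 1 else (X : ℚ[X])) (ω * swap r s)).det
  set g : V → V → ℚ[X] := fun r s =>
    (permDiff (fun i => if i = r ∨ i = s then 1 else (X : ℚ[X])) ω).det
  have hg (r s : V) : g r s = g s r := by simp only [g, or_comm]
  have hpair (r s : V) : (if r = s then 0 else pairPoly q ω r s) =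
      (if r = s then 0 else f r s) +
        C q * ((if ω r = s then g r s else 0) + if ω s = r then g s r else 0) := by
    have h1 := hω r
    have h2 := hω2 r
    rw [pairPoly, ← hg r s]
    by_cases hrs : r = s
    · subst hrs
      simp [h1]
    by_cases h3 : ω r = s
    · subst h3
      simp [hrs, h2, f, g]
    by_cases h4 : ω s = r
    · simp [hrs, h3, h4, f, g]
    · simp [hrs, h3, h4, f]
  have hsum : ∑ r, ∑ s, (if r = s then 0 else pairPoly q ω r s) =
      ∑ r, ∑ s, (if r = s then 0 else f r s) + C (2 * q) * ∑ r, g r (ω r) := by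
    simp only [hpair, Finset.sum_add_distrib, ← Finset.mul_sum]
    congr 1
    have h1 : ∑ r, ∑ s, (if ω s = r then g s r else 0) = ∑ r, g r (ω r) := by
      rw [Finset.sum_comm]
      simp
    rw [h1]
    simp only [Finset.sum_ite_eq, Finset.mem_univ, if_true, map_mul]
    have : (C 2 : ℚ[X]) = 2 := rfl
    rw [this]
    ring
  have h1 := congrArg (fallEval q (m + 1)) (sum_det_permDiff_two_mul_swap ω)
  have h2 := congrArg (fallEval (q - 1) m) (sum_det_permDiff_two ω hω)
  rw [fallEval_X_sub_one_mul] at h1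
  rw [fallEval_X_mul, sub_add_cancel] at h2
  rw [hm] at h1 h2
  have hm0 : (m : ℚ) + 1 ≠ 0 := by positivity
  rw [hsum, map_add, fallEval_C_mul, hookFunctional, Nat.add_sub_cancel, ← h1, ← h2]
  push_cast
  rw [inv_mul_cancel_left₀ hm0]

end Averaging

section Assembly

open Equiv

variable {V W : Type*} [Fintype V] [DecidableEq V] [Fintype W] [DecidableEq W]

lemma card_cycleCount_eq_one [Nonempty V] :
    (Fintype.card V * (Fintype.card V + 1) : ℚ) *
        (Finset.univ.filter fun α : Perm V => cycleCount α = 1).card =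
      (Fintype.card V + 1).factorial := by
  have h := fullCycleSum_eq 1 (1 : Perm V)
  have h1 := permCharpoly_cycleType (1 : Perm V)
  have h2 := fallEval_X_sub_one_pow_mul 1 1 (Fintype.card V) 1
  simp only [Perm.cycleType_one, Multiset.sum_zero, pow_zero, one_mul, Multiset.map_zero,
    Multiset.prod_zero] at h1
  rw [h1, add_comm (Fintype.card V) 1, h2, fallEval_one] at h
  simp only [fullCycleSum, one_pow, ← Finset.sum_filter, Finset.sum_const, nsmul_eq_mul,
    mul_one] at h
  rw [h, add_comm]
  simp

lemma cycleType_of_cycleCount_eq_one {α : Perm V} (h : cycleCount α = 1)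
    (hV : 2 ≤ Fintype.card V) : α.cycleType = {Fintype.card V} := by
  have hle := sum_cycleType_le α
  rw [cycleCount] at h
  have hcard : Multiset.card α.cycleType = 1 := by
    rcases Nat.eq_zero_or_pos (Multiset.card α.cycleType) with h0 | h0
    · rw [Multiset.card_eq_zero.1 h0] at h
      simp at h
      omega
    · omega
  obtain ⟨k, hk⟩ := Multiset.card_eq_one.1 hcard
  rw [hk] at h hle ⊢
  simp only [Multiset.card_singleton, Multiset.sum_singleton] at h hle
  congr 1
  omega

lemma cycleType_swap_mul_optionCongr {α : Perm V} (h : cycleCount α = 1)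
    (hV : 2 ≤ Fintype.card V) :
    (swap none (some none) * optionCongr (optionCongr α) : Perm (Option (Option V))).cycleType =
      {2, Fintype.card V} := by
  have hd : Perm.Disjoint (swap none (some none) : Perm (Option (Option V)))
      (optionCongr (optionCongr α)) := by
    rintro (_ | _ | x)
    · right; rfl
    · right; rfl
    · left; exact swap_apply_of_ne_of_ne (by simp) (by simp)
  rw [hd.cycleType_mul, cycleType_optionCongr, cycleType_optionCongr,
    cycleType_of_cycleCount_eq_one h hV, (Perm.isCycle_swap (by simp)).cycleType,
    Perm.card_support_swap (by simp)]
  rfl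

lemma sum_pow_cycleCount_congr (q : ℚ) (β : Multiset ℕ) {α α' : Perm V}
    (h : α.cycleType = α'.cycleType) :
    ∑ ω : Perm V with ω.cycleType = β, q ^ cycleCount (α * ω) =
      ∑ ω : Perm V with ω.cycleType = β, q ^ cycleCount (α' * ω) := by
  obtain ⟨g, rfl⟩ := isConj_iff.1 (Perm.isConj_iff_cycleType_eq.2 h)
  symm
  rw [Finset.sum_filter, Finset.sum_filter, ← Equiv.sum_comp (MulAut.conj g).toEquiv]
  refine Finset.sum_congr rfl fun ω _ => ?_
  have h1 : g * α * g⁻¹ * (MulAut.conj g) ω = g * (α * ω) * g⁻¹ := by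
    rw [MulAut.conj_apply]; group
  simp only [MulEquiv.toEquiv_eq_coe, EquivLike.coe_coe, h1]
  rw [MulAut.conj_apply, Perm.cycleType_conj, cycleCount, cycleCount, Perm.cycleType_conj]

lemma sum_pow_cycleCount_option (q : ℚ) {β : Multiset ℕ} (hβ3 : ∀ k ∈ β, 3 ≤ k)
    (hV : 2 ≤ Fintype.card V) (hβ : β.sum = Fintype.card V + 2) {α : Perm (Option (Option V))}
    (hα : α.cycleType = {2, Fintype.card V}) :
    ((Fintype.card V + 2) * (Fintype.card V + 1) * (Fintype.card V + 1).factorial : ℚ) *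
        ∑ ω : Perm (Option (Option V)) with ω.cycleType = β, q ^ cycleCount (α * ω) =
      (Finset.univ.filter fun ω : Perm (Option (Option V)) => ω.cycleType = β).card *
        hookFunctional q (Fintype.card V + 2) (β.map fun k => (X : ℚ[X]) ^ k - 1).prod := by
  have : Nonempty V := Fintype.card_pos_iff.1 (by omega)
  set m := Fintype.card V with hm
  have hcard : Fintype.card (Option (Option V)) = m + 2 := by simp [hm]
  have hsum {ω : Perm (Option (Option V))} (hω : ω.cycleType = β) :
      ω.cycleType.sum = Fintype.card (Option (Option V)) := by rw [hω, hβ, hcard]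
  have hfix {ω : Perm (Option (Option V))} (hω : ω.cycleType = β) (x) : ω x ≠ x :=
    apply_ne_of_sum_eq (hsum hω) x
  have hfix2 {ω : Perm (Option (Option V))} (hω : ω.cycleType = β) (x) : ω (ω x) ≠ x :=
    apply_apply_ne (hsum hω) (hω ▸ hβ3) x
  set A := ∑ ω : Perm (Option (Option V)) with ω.cycleType = β, q ^ cycleCount (α * ω) with hA
  set C' := Finset.univ.filter fun ω : Perm (Option (Option V)) => ω.cycleType = β
  have hmemC {ω : Perm (Option (Option V))} (hω : ω ∈ C') : ω.cycleType = β :=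
    (Finset.mem_filter.1 hω).2
  have hN : ((Finset.univ.filter fun α : Perm V => cycleCount α = 1).card : ℚ) * A =
      ∑ ω ∈ C', q ^ ((if removeNone (ω * swap none (some none)) none = none then 1 else 0) +
          if (ω * swap none (some none) : Perm (Option (Option V))) none = none then 1 else 0) *
        fullCycleSum q (removeNone (removeNone (ω * swap none (some none)))) := by
    have h1 : ∀ α' ∈ Finset.univ.filter fun α : Perm V => cycleCount α = 1,
        A = ∑ ω ∈ C', q ^ cycleCount (swap none (some none) * optionCongr (optionCongr α') * ω) := by
      intro α' hα'
      refine sum_pow_cycleCount_congr q β ?_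
      rw [hα, cycleType_swap_mul_optionCongr (Finset.mem_filter.1 hα').2 hV]
    rw [← nsmul_eq_mul, ← Finset.sum_const, Finset.sum_congr rfl h1, Finset.sum_comm]
    refine Finset.sum_congr rfl fun ω _ => ?_
    rw [fullCycleSum, ← Finset.sum_filter, Finset.mul_sum]
    refine Finset.sum_congr rfl fun α' _ => ?_
    rw [cycleCount_mul_comm, ← mul_assoc, cycleCount_mul_optionCongr_optionCongr, pow_add, mul_comm]
  have hpair : (m * (m + 1) : ℚ) *
      ((Finset.univ.filter fun α : Perm V => cycleCount α = 1).card * A) =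
      fallEval q (m + 1) (∑ ω ∈ C', pairPoly q ω none (some none)) := by
    rw [hN, map_sum, Finset.mul_sum]
    refine Finset.sum_congr rfl fun ω hω => ?_
    rw [pairPoly_none q (hfix (hmemC hω)) (hfix2 (hmemC hω)), fallEval_C_mul, ← fullCycleSum_eq]
    ring
  have hav := congrArg (fallEval q (m + 1))
    (sum_sum_pairPoly q β (V := Option (Option V)) (r₀ := none) (s₀ := some none) (by simp))
  have hhook : ∀ ω ∈ C', fallEval q (m + 1)
      (∑ r, ∑ s, (if r = s then 0 else pairPoly q ω r s)) =
        hookFunctional q (m + 2) (β.map fun k => (X : ℚ[X]) ^ k - 1).prod := by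
    intro ω hω
    rw [fallEval_sum_pairPoly q hcard (hfix (hmemC hω)) (hfix2 (hmemC hω)),
      permCharpoly_of_sum_eq (hsum (hmemC hω)), hmemC hω]
  rw [map_sum, Finset.sum_congr rfl hhook, Finset.sum_const, nsmul_eq_mul, hcard] at hav
  have hC : ((m + 2 : ℕ) : ℚ[X]) * (((m + 2 : ℕ) : ℚ[X]) - 1) = C ((m + 2) * (m + 1) : ℚ) := by
    simp only [map_mul, map_add, map_natCast, map_one, map_ofNat]
    push_cast
    ring
  rw [hC, fallEval_C_mul, ← hpair, ← mul_assoc (m * (m + 1) : ℚ), card_cycleCount_eq_one] at hav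
  rw [hav]
  ring

end Assembly

lemma numCycles_eq_cycleCount {n : ℕ} (σ : Equiv.Perm (Fin n)) : numCycles σ = cycleCount σ := by
  rw [numCycles, fullCycleType, cycleCount, Multiset.card_add, Multiset.card_replicate,
    Fintype.card_fin]

lemma fullCycleType_eq_iff {n : ℕ} {β : Multiset ℕ} (hβ : 1 ∉ β) (hsum : β.sum = n)
    (σ : Equiv.Perm (Fin n)) : fullCycleType σ = β ↔ σ.cycleType = β := by
  constructor
  · intro h
    have h0 : n - σ.cycleType.sum = 0 := by
      by_contra h0
      refine hβ ?_
      rw [← h, fullCycleType, Multiset.mem_add]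
      exact Or.inr (Multiset.mem_replicate.2 ⟨h0, rfl⟩)
    rwa [fullCycleType, h0, Multiset.replicate_zero, add_zero] at h
  · intro h
    rw [fullCycleType, h, hsum]
    simp

lemma eval_Pperm (q : ℚ) {n : ℕ} (hn : 4 ≤ n) {β : Multiset ℕ} (hβ3 : ∀ k ∈ β, 3 ≤ k)
    (hβ : β.sum = n) {α : Equiv.Perm (Fin n)} (hα : fullCycleType α = {2, n - 2}) :
    (Pperm α β).eval q =
      hookFunctional q n (β.map fun k => (X : ℚ[X]) ^ k - 1).prod / (n - 1).factorial := by
  obtain ⟨m, rfl⟩ : ∃ m, n = m + 2 := ⟨n - 2, by omega⟩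
  have h1 : 1 ∉ β := fun h => by simpa using hβ3 1 h
  have hα' : α.cycleType = {2, m} := by
    rw [fullCycleType_eq_iff] at hα
    · exact hα
    · simp; omega
    · simp; omega
  let e : Fin (m + 2) ≃ Option (Option (Fin m)) :=
    (finSuccEquiv (m + 1)).trans (Equiv.optionCongr (finSuccEquiv m))
  have key := sum_pow_cycleCount_option q (V := Fin m) (α := e.permCongr α) hβ3
    (by simpa using by omega) (by simpa using hβ) (by simpa [cycleType_permCongr] using hα')
  have hC : permClass (m + 2) β = Finset.univ.filter fun ω => ω.cycleType = β := by
    ext ω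
    simp [permClass, fullCycleType_eq_iff h1 hβ]
  have hcard : (Finset.univ.filter fun ω : Equiv.Perm (Option (Option (Fin m))) =>
      ω.cycleType = β).card = (permClass (m + 2) β).card := by
    rw [hC]
    refine (Finset.card_equiv e.permCongr fun ω => ?_).symm
    simp [cycleType_permCongr]
  have hpos : ((permClass (m + 2) β).card : ℚ) ≠ 0 := by
    obtain ⟨ω, hω⟩ := (Equiv.Perm.exists_with_cycleType_iff (α := Fin (m + 2)) (m := β)).2
      ⟨by simp [hβ], fun k hk => by have := hβ3 k hk; omega⟩
    rw [Nat.cast_ne_zero, hC]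
    exact Finset.card_ne_zero_of_mem (Finset.mem_filter.2 ⟨Finset.mem_univ ω, hω⟩)
  have hsum : ∑ ω : Equiv.Perm (Option (Option (Fin m))) with ω.cycleType = β,
      q ^ cycleCount (e.permCongr α * ω) =
        ∑ ω ∈ permClass (m + 2) β, q ^ numCycles (α * ω) := by
    rw [hC, Finset.sum_filter, Finset.sum_filter, ← Equiv.sum_comp e.permCongr]
    refine Finset.sum_congr rfl fun ω _ => ?_
    have h : e.permCongr α * e.permCongr ω = e.permCongr (α * ω) := by
      ext x; simp
    rw [h, cycleType_permCongr, cycleCount_permCongr, numCycles_eq_cycleCount]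
  rw [hsum, hcard, Fintype.card_fin] at key
  have hfact : (((m + 2 - 1).factorial : ℕ) : ℚ) ≠ 0 := by
    exact_mod_cast Nat.factorial_ne_zero _
  rw [Pperm, eval_mul, eval_C, eval_finsetSum, eq_div_iff hfact, div_mul_eq_mul_div,
    div_mul_eq_mul_div, div_eq_iff hpos]
  simp only [eval_pow, eval_X]
  rw [mul_comm (hookFunctional _ _ _), ← key]
  push_cast
  ring

/-- decomposition of `P_{[2,n−2],β}` as a linear combination of the
polynomials `P̃_i` attached to hook partitions `[1^{n−i}, i]`. -/
theorem Pperm_decomposition (n d : ℕ) (hn : 6 ≤ n) (β : Fin d → ℕ)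
    (hβ3 : ∀ i, 3 ≤ β i) (hsum : ∑ i, β i = n)
    (a : ℕ → ℚ)
    (ha : (∏ i, ((MvPolynomial.X 0) ^ (β i) - (MvPolynomial.X 1) ^ (β i)) :
            MvPolynomial (Fin 2) ℚ) =
          ∑ i ∈ Finset.Icc 1 n, a i •
            (((MvPolynomial.X 0 - MvPolynomial.X 1) : MvPolynomial (Fin 2) ℚ) ^ (n - i) *
              ((MvPolynomial.X 0) ^ i - (MvPolynomial.X 1) ^ i)))
    (α : Equiv.Perm (Fin n)) (hα : fullCycleType α = ({2, n - 2} : Multiset ℕ)) :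
    Pperm α (Multiset.map β Finset.univ.val) =
      ∑ i ∈ Finset.Icc 1 n, a i •
        (2 * Polynomial.X ^ 2 *
            (binomPoly ((i : ℤ) - 2) ((i : ℤ) - 2) - binomPoly (-2) ((i : ℤ) - 2))
          + Polynomial.X * (Polynomial.X + 1) *
            (binomPoly ((i : ℤ) - 2) ((i : ℤ) - 3) - binomPoly (-2) ((i : ℤ) - 3))) := by
  have hF : ∏ i, ((X : ℚ[X]) ^ β i - 1) =
      ∑ i ∈ Finset.Icc 1 n, C (a i) * ((X - 1) ^ (n - i) * (X ^ i - 1)) := by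
    have h := congrArg (MvPolynomial.aeval ![(X : ℚ[X]), 1]) ha
    simpa [map_prod, map_sum, smul_eq_C_mul] using h
  refine Polynomial.funext fun q => ?_
  rw [eval_Pperm q (by omega) (by simpa using hβ3) hsum hα, Multiset.map_map]
  have hprod : (Finset.univ.val.map ((fun k => (X : ℚ[X]) ^ k - 1) ∘ β)).prod =
      ∏ i, ((X : ℚ[X]) ^ β i - 1) := rfl
  rw [hprod, hF, hookFunctional_sum, Finset.sum_div, eval_finsetSum]
  refine Finset.sum_congr rfl fun i hi => ?_
  obtain ⟨hi1, hin⟩ := Finset.mem_Icc.1 hi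
  rw [hookFunctional_C_mul, eval_smul, eval_hook q i (n - i) hi1, Nat.add_sub_cancel' hin,
    smul_eq_mul, mul_div_assoc]
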